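/- arXiv:1904.07443 — 2 statements merged into one kernel-verified Lean document; each statement's English description precedes it below -/
import Mathlib

section
/- Let 0 < s < 1 and let f : [−1,1] → ℝ be C^{1,α} with α > max{0, 1−2s}. Let u be a stable solution of (−Δ)^s u = f(u) in ℝ² with |u| < 1. Then u is one-dimensional: there exist a unit vector e ∈ ℝ² and a function g : ℝ → ℝ such that u(x) = g(x·e) for all x ∈ ℝ². -/
open MeasureTheory Metric Set
open scoped ENNReal NNReal

/-- The fractional `s`-energy `J^s(u,Ω)` of `u : ℝ^d → ℝ` on an open set `Ω`:
`J^s(u,Ω) = ∬_{(ℝ^d×ℝ^d)∖(Ωᶜ×Ωᶜ)} |u(x)−u(y)|²/|x−y|^{d+2s} dy dx`, valued in `[0,∞]`. -/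
noncomputable def Js (d : ℕ) (s : ℝ) (u : EuclideanSpace ℝ (Fin d) → ℝ)
    (Ω : Set (EuclideanSpace ℝ (Fin d))) : ℝ≥0∞ :=
  ∫⁻ p : EuclideanSpace ℝ (Fin d) × EuclideanSpace ℝ (Fin d) in (Ωᶜ ×ˢ Ωᶜ)ᶜ,
    ENNReal.ofReal ((u p.1 - u p.2)^2 / ‖p.1 - p.2‖ ^ ((d : ℝ) + 2*s))

/-- The normalizing constant `C(d,s) = 2^{2s} Γ(d/2+s) / (π^{d/2} |Γ(−s)|)` of the fractional
Laplacian, which normalizes its Fourier symbol to `|ξ|^{2s}`. -/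
noncomputable def fracC (d : ℕ) (s : ℝ) : ℝ :=
  2 ^ (2*s) * Real.Gamma ((d : ℝ)/2 + s) / (Real.pi ^ ((d : ℝ)/2) * |Real.Gamma (-s)|)

/-- `f : [−1,1] → ℝ` is `C^{1,α}`: it has derivative `f'` on `[−1,1]` and `f'` is
`α`-Hölder continuous on `[−1,1]`. -/
def IsC1Alpha (f f' : ℝ → ℝ) (α : ℝ) : Prop :=
  (∀ x ∈ Set.Icc (-1 : ℝ) 1, HasDerivAt f (f' x) x) ∧
  ∃ Cα : ℝ, 0 ≤ Cα ∧ ∀ x ∈ Set.Icc (-1 : ℝ) 1, ∀ y ∈ Set.Icc (-1 : ℝ) 1,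
    |f' x - f' y| ≤ Cα * |x - y| ^ α

/-- `u ∈ C²(ℝ^d)` with `|u| ≤ 1` is a stable solution of `(−Δ)^s u = f(u)` in `ℝ^d`:
the equation `(C(d,s)/2)∫ (2u(x)−u(x+y)−u(x−y))/|y|^{d+2s} dy = f(u(x))` holds pointwise and
for every `η ∈ C_c^∞(ℝ^d)` one has
`(C(d,s)/2) ∬ |η(x)−η(y)|²/|x−y|^{d+2s} dx dy ≥ ∫ f'(u(x)) η(x)² dx`. -/
def IsStableSolution (d : ℕ) (s : ℝ) (f f' : ℝ → ℝ)
    (u : EuclideanSpace ℝ (Fin d) → ℝ) : Prop :=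
  ContDiff ℝ 2 u ∧ (∀ x, |u x| ≤ 1) ∧
  (∀ x : EuclideanSpace ℝ (Fin d),
    fracC d s / 2 * ∫ y : EuclideanSpace ℝ (Fin d),
      (2 * u x - u (x + y) - u (x - y)) / ‖y‖ ^ ((d : ℝ) + 2*s) = f (u x)) ∧
  (∀ η : EuclideanSpace ℝ (Fin d) → ℝ, ContDiff ℝ (⊤ : ℕ∞) η → HasCompactSupport η →
    ∫ x : EuclideanSpace ℝ (Fin d), f' (u x) * (η x)^2 ≤
      fracC d s / 2 * ∫ x : EuclideanSpace ℝ (Fin d), ∫ y : EuclideanSpace ℝ (Fin d),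
        (η x - η y)^2 / ‖x - y‖ ^ ((d : ℝ) + 2*s))


namespace FL
abbrev E2 := EuclideanSpace ℝ (Fin 2)

noncomputable def K (s : ℝ) (z : E2) : ℝ := (‖z‖ ^ (2 + 2*s))⁻¹

lemma K_nonneg (s : ℝ) (z : E2) : 0 ≤ K s z := by unfold K; positivity

lemma K_neg (s : ℝ) (z : E2) : K s (-z) = K s z := by simp [K]

lemma K_meas (s : ℝ) : Measurable (K s) := by unfold K; fun_prop

/-- integrable weight -/
noncomputable def mK (s : ℝ) (z : E2) : ℝ := min 1 (‖z‖^2) * K s z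

lemma mK_nonneg (s : ℝ) (z : E2) : 0 ≤ mK s z := by
  have := K_nonneg s z
  unfold mK; positivity

lemma mK_neg (s : ℝ) (z : E2) : mK s (-z) = mK s z := by simp [mK, K_neg]

lemma mK_meas (s : ℝ) : Measurable (mK s) := by
  have := K_meas s
  unfold mK; fun_prop

lemma mK_integrable {s : ℝ} (h0 : 0 < s) (h1 : s < 1) : Integrable (mK s) := by
  have : mK s = fun z : E2 => (fun r : ℝ => min 1 (r^2) * (r^(2+2*s))⁻¹) ‖z‖ := rfl
  rw [this]
  refine (integrable_fun_norm_addHaar (volume : Measure E2)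
    (f := fun r : ℝ => min 1 (r^2) * (r^(2+2*s))⁻¹)).2 ?_
  have hd : Module.finrank ℝ E2 - 1 = 1 := by simp
  rw [hd, ← Ioc_union_Ioi_eq_Ioi (zero_le_one (α := ℝ))]
  refine IntegrableOn.union ?_ ?_
  · have h : IntegrableOn (fun r : ℝ => r ^ (1 - 2*s)) (Ioc 0 1) := by
      rw [← intervalIntegrable_iff_integrableOn_Ioc_of_le zero_le_one]
      exact intervalIntegral.intervalIntegrable_rpow' (by linarith)
    refine h.congr_fun ?_ measurableSet_Ioc
    rintro r ⟨hr0, hr1⟩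
    have : min 1 (r^2) = r^2 := min_eq_right (by nlinarith)
    simp only [this, smul_eq_mul, pow_one]
    rw [← Real.rpow_neg hr0.le, ← Real.rpow_natCast, ← Real.rpow_add hr0]
    nth_rw 2 [← Real.rpow_one r]
    rw [← Real.rpow_add hr0]
    congr 1; push_cast; ring
  · have h : IntegrableOn (fun r : ℝ => r ^ (-1 - 2*s)) (Ioi 1) :=
      integrableOn_Ioi_rpow_of_lt (by linarith) one_pos
    refine h.congr_fun ?_ measurableSet_Ioi
    intro r (hr : 1 < r)
    have hr0 : 0 < r := by linarith
    have : min 1 (r^2) = 1 := min_eq_left (by nlinarith)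
    simp only [this, smul_eq_mul, pow_one, one_mul]
    rw [← Real.rpow_neg hr0.le]
    nth_rw 2 [← Real.rpow_one r]
    rw [← Real.rpow_add hr0]
    congr 1; ring

def T (p : E2 × E2) : E2 × E2 := (p.1 + p.2, -p.2)

lemma T_T (p : E2 × E2) : T (T p) = p := by ext <;> simp [T]

lemma T_meas : Measurable T := by unfold T; fun_prop

lemma T_mp : MeasurePreserving T (volume : Measure (E2 × E2)) volume := by
  have h1 := measurePreserving_add_prod (volume : Measure E2) (volume : Measure E2)
  have h2 := (MeasurePreserving.id (volume : Measure E2)).prod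
    (Measure.measurePreserving_neg (volume : Measure E2))
  exact h2.comp h1

lemma T_emb : MeasurableEmbedding T :=
  (MeasurableEquiv.mk ⟨T, T, T_T, T_T⟩ T_meas T_meas).measurableEmbedding

/-- indicator weight -/
noncomputable def ind (R : ℝ) (x : E2) : ℝ := (closedBall (0:E2) R).indicator (fun _ => (1:ℝ)) x

lemma ind_nonneg (R : ℝ) (x : E2) : 0 ≤ ind R x := indicator_nonneg (by simp) _
lemma ind_of {R : ℝ} {x : E2} (h : ‖x‖ ≤ R) : ind R x = 1 := by
  simp [ind, indicator, h]
lemma ind_of_not {R : ℝ} {x : E2} (h : ¬ ‖x‖ ≤ R) : ind R x = 0 := by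
  simp [ind, indicator, h]
lemma ind_le_one (R : ℝ) (x : E2) : ind R x ≤ 1 := by
  by_cases h : ‖x‖ ≤ R
  · simp [ind_of h]
  · simp [ind_of_not h]
lemma ind_meas (R : ℝ) : Measurable (ind R) :=
  measurable_const.indicator measurableSet_closedBall
lemma ind_integrable (R : ℝ) : Integrable (ind R) :=
  (integrable_indicator_iff measurableSet_closedBall).2
    (integrableOn_const (by exact measure_closedBall_lt_top.ne))

lemma W1_integrable {s : ℝ} (h0 : 0 < s) (h1 : s < 1) (R : ℝ) :
    Integrable (fun p : E2 × E2 => ind R p.1 * mK s p.2) :=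
  (ind_integrable R).mul_prod (mK_integrable h0 h1)

lemma W2_integrable {s : ℝ} (h0 : 0 < s) (h1 : s < 1) (R : ℝ) :
    Integrable (fun p : E2 × E2 => ind R (p.1 + p.2) * mK s p.2) := by
  have := T_mp.integrable_comp_of_integrable (W1_integrable h0 h1 R)
  refine this.congr (ae_of_all _ fun p => ?_)
  simp [T, mK_neg]

/-- domination lemma -/
lemma dom {s : ℝ} (h0 : 0 < s) (h1 : s < 1) (R C : ℝ) (F : E2 × E2 → ℝ)
    (hF : AEStronglyMeasurable F)
    (hb : ∀ p : E2 × E2, |F p| ≤ C * min 1 (‖p.2‖^2) * (ind R p.1 + ind R (p.1 + p.2))) :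
    Integrable (fun p : E2 × E2 => F p * K s p.2) := by
  refine (((W1_integrable h0 h1 R).add (W2_integrable h0 h1 R)).const_mul C).mono'
    (hF.mul ((K_meas s).comp measurable_snd).aestronglyMeasurable) (ae_of_all _ fun p => ?_)
  rw [Real.norm_eq_abs, abs_mul, abs_of_nonneg (K_nonneg _ _)]
  refine (mul_le_mul_of_nonneg_right (hb p) (K_nonneg _ _)).trans (le_of_eq ?_)
  simp only [Pi.add_apply, mK]; ring

lemma int_fderiv_zero {V : Type*} [NormedAddCommGroup V] [NormedSpace ℝ V] [FiniteDimensional ℝ V]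
    [MeasurableSpace V] [BorelSpace V] (μ : Measure V) [μ.IsAddHaarMeasure]
    {F : V → ℝ} (hF : ContDiff ℝ 1 F) (hc : HasCompactSupport F) (v : V) :
    ∫ x, fderiv ℝ F x v ∂μ = 0 := by
  have hi : Integrable (fun x => fderiv ℝ F x v) μ := by
    refine Continuous.integrable_of_hasCompactSupport ?_ ?_
    · exact (hF.continuous_fderiv (by norm_num)).clm_apply continuous_const
    · exact hc.fderiv_apply (𝕜 := ℝ) v
  have := integral_smul_fderiv_eq_neg_fderiv_smul_of_integrable (μ := μ) (𝕜 := ℝ)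
    (f := fun _ : V => (1:ℝ)) (g := F) (v := v) (by simp) (by simpa using hi)
    (by simpa using hF.continuous.integrable_of_hasCompactSupport hc)
    (by fun_prop) (fun x _ => (hF.differentiable (by norm_num)).differentiableAt)
  simpa using this

/-- second difference bound -/
lemma second_diff {F : E2 → ℝ} (hF : ContDiff ℝ 2 F) {M : ℝ} {x z : E2}
    (hM : ∀ y ∈ closedBall x ‖z‖, ‖fderiv ℝ (fderiv ℝ F) y‖ ≤ M) :
    |2 * F x - F (x + z) - F (x - z)| ≤ M * ‖z‖^2 := by
  have hd : Differentiable ℝ F := hF.differentiable (by norm_num)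
  have hF1 : ContDiff ℝ 1 (fderiv ℝ F) := hF.fderiv_right (by norm_num)
  have hd1 : Differentiable ℝ (fderiv ℝ F) := hF1.differentiable (by norm_num)
  have key : ∀ y ∈ segment ℝ (x - z) x, ‖fderiv ℝ (fun y => F (y + z) - F y) y‖ ≤ M * ‖z‖ := by
    intro y hy
    have e1 : fderiv ℝ (fun y => F (y + z) - F y) y = fderiv ℝ F (y + z) - fderiv ℝ F y := by
      rw [fderiv_fun_sub (by fun_prop) (by fun_prop), fderiv_comp_add_right]
    rw [e1]
    have hseg : segment ℝ y (y+z) ⊆ closedBall x ‖z‖ := by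
      apply (convex_closedBall x ‖z‖).segment_subset
      · refine (convex_closedBall x ‖z‖).segment_subset ?_ ?_ hy <;> simp
      · obtain ⟨a, b, ha, hb, hab, rfl⟩ := hy
        have : a • (x - z) + b • x + z = x + b • z := by
          have : a = 1 - b := by linarith
          subst this; module
        rw [this]
        simp only [mem_closedBall, dist_self_add_left, norm_smul, Real.norm_eq_abs, abs_of_nonneg hb]
        have := norm_nonneg z
        nlinarith
    have := (convex_segment y (y+z)).norm_image_sub_le_of_norm_fderiv_le (𝕜 := ℝ)
      (f := fderiv ℝ F) (fun w _ => hd1.differentiableAt) (fun w hw => hM w (hseg hw))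
      (left_mem_segment ℝ y (y+z)) (right_mem_segment ℝ y (y+z))
    simpa using this
  have := (convex_segment (x - z) x).norm_image_sub_le_of_norm_fderiv_le (𝕜 := ℝ)
      (f := fun y => F (y + z) - F y)
      (fun w _ => by fun_prop) key (left_mem_segment ℝ _ _) (right_mem_segment ℝ _ _)
  rw [Real.norm_eq_abs] at this
  simp only [sub_add_cancel, sub_sub_cancel] at this
  rw [abs_sub_comm]
  calc _ = |F (x + z) - F x - (F x - F (x - z))| := by congr 1; ring
    _ ≤ _ := this
    _ = _ := by ring
end FL


namespace FL
lemma lipdom {Λ M R : ℝ} {η : E2 → ℝ} (hΛ : ∀ x y, |η x - η y| ≤ Λ * ‖x - y‖) (hM : ∀ x, |η x| ≤ M)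
    (hR : ∀ x, R < ‖x‖ → η x = 0) (p : E2 × E2) :
    |(η p.1 - η (p.1 + p.2))^2| ≤ (Λ^2 + 4*M^2) * min 1 (‖p.2‖^2) * (ind R p.1 + ind R (p.1 + p.2)) := by
  obtain ⟨x, z⟩ := p
  simp only
  have hb1 : (η x - η (x+z))^2 ≤ Λ^2 * ‖z‖^2 := by
    have := hΛ x (x+z)
    simp only [sub_add_cancel_left, norm_neg] at this
    rw [← sq_abs, ← mul_pow]
    gcongr
  have hb2 : (η x - η (x+z))^2 ≤ 4*M^2 := by
    have h1 := hM x
    have h2 := hM (x+z)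
    rw [abs_le] at h1 h2
    nlinarith
  have hb : (η x - η (x+z))^2 ≤ (Λ^2 + 4*M^2) * min 1 (‖z‖^2) := by
    rcases min_cases 1 (‖z‖^2) with ⟨h, _⟩ | ⟨h, _⟩ <;> rw [h]
    · nlinarith [sq_nonneg Λ]
    · nlinarith [sq_nonneg M, sq_nonneg ‖z‖, mul_nonneg (sq_nonneg M) (sq_nonneg ‖z‖)]
  rw [abs_of_nonneg (sq_nonneg _)]
  by_cases h1 : ‖x‖ ≤ R
  · refine hb.trans (le_mul_of_one_le_right ((sq_nonneg _).trans hb) ?_)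
    rw [ind_of h1]; linarith [ind_nonneg R (x+z)]
  by_cases h2 : ‖x+z‖ ≤ R
  · refine hb.trans (le_mul_of_one_le_right ((sq_nonneg _).trans hb) ?_)
    rw [ind_of h2]; linarith [ind_nonneg R x]
  · rw [hR x (not_le.1 h1), hR _ (not_le.1 h2), ind_of_not h1, ind_of_not h2]; simp

lemma lipint {s : ℝ} (h0 : 0 < s) (h1 : s < 1)
    {Λ M R : ℝ} {η : E2 → ℝ} (hΛ : ∀ x y, |η x - η y| ≤ Λ * ‖x - y‖) (hM : ∀ x, |η x| ≤ M)
    (hR : ∀ x, R < ‖x‖ → η x = 0) (hc : Continuous η) :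
    Integrable (fun p : E2 × E2 => (η p.1 - η (p.1 + p.2))^2 * K s p.2) :=
  dom h0 h1 R _ (fun p : E2 × E2 => (η p.1 - η (p.1 + p.2))^2)
    (by apply Continuous.aestronglyMeasurable; fun_prop) (lipdom hΛ hM hR)

lemma iter_eq {s : ℝ} (F : E2 → E2 → ℝ)
    (hi : Integrable (fun p : E2 × E2 => F p.1 (p.1 + p.2) * K s p.2)) :
    ∫ x : E2, ∫ y : E2, F x y / ‖x - y‖ ^ (((2:ℕ):ℝ) + 2*s) =
      ∫ p : E2 × E2, F p.1 (p.1 + p.2) * K s p.2 := by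
  rw [Measure.volume_eq_prod, integral_prod _ (by rwa [← Measure.volume_eq_prod])]
  congr 1; ext x
  rw [← integral_add_left_eq_self _ x]
  congr 1; ext z
  simp [K, div_eq_mul_inv]

lemma stab_lip {s : ℝ} (h0 : 0 < s) (h1 : s < 1) {c : ℝ} {q : E2 → ℝ} (hq : Continuous q)
    (hst : ∀ η : E2 → ℝ, ContDiff ℝ (⊤ : ℕ∞) η → HasCompactSupport η →
      ∫ x, q x * (η x)^2 ≤ c / 2 * ∫ x : E2, ∫ y : E2, (η x - η y)^2 / ‖x - y‖ ^ (((2:ℕ):ℝ) + 2*s))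
    {Λ M R : ℝ} {w : E2 → ℝ} (hΛ : ∀ x y, |w x - w y| ≤ Λ * ‖x - y‖) (hM : ∀ x, |w x| ≤ M)
    (hR : ∀ x, R < ‖x‖ → w x = 0) (hc : Continuous w) :
    ∫ x, q x * (w x)^2 ≤ c / 2 * ∫ p : E2 × E2, (w p.1 - w (p.1 + p.2))^2 * K s p.2 := by
  have hΛ0 : 0 ≤ Λ := by
    have := hΛ (EuclideanSpace.single 0 1) 0
    have h := (abs_nonneg _).trans this
    simpa using h
  have hM0 : 0 ≤ M := (abs_nonneg _).trans (hM 0)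
  let φ : ℕ → ContDiffBump (0 : E2) := fun n =>
    ⟨1/(2*((n:ℝ)+1)), 1/((n:ℝ)+1), by positivity, by
      apply one_div_lt_one_div_of_lt <;> [positivity; nlinarith [(n.cast_nonneg : (0:ℝ) ≤ n)]]⟩
  have hrout : ∀ n, (φ n).rOut = 1/((n:ℝ)+1) := fun n => rfl
  have hrout1 : ∀ n, (φ n).rOut ≤ 1 := fun n => by
    rw [hrout, div_le_one (by positivity)]; linarith [(n.cast_nonneg : (0:ℝ) ≤ n)]
  have wc : HasCompactSupport w := HasCompactSupport.intro (isCompact_closedBall 0 R) (fun x hx => hR x (by simpa using hx))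
  let η : ℕ → E2 → ℝ := fun n => convolution ((φ n).normed volume) w (ContinuousLinearMap.lsmul ℝ ℝ) volume
  have ηdef : ∀ n x, η n x = ∫ t, (φ n).normed volume t * w (x - t) := fun n x => by
    simp [η, convolution]
  have ηsm : ∀ n, ContDiff ℝ (⊤ : ℕ∞) (η n) := fun n =>
    (φ n).hasCompactSupport_normed.contDiff_convolution_left _ (φ n).contDiff_normed
      hc.locallyIntegrable
  have ηc : ∀ n, HasCompactSupport (η n) := fun n =>
    HasCompactSupport.convolution _ (φ n).hasCompactSupport_normed wc
  have ηd : ∀ n x, |η n x - w x| ≤ Λ * (1/((n:ℝ)+1)) := fun n x => by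
    have := (φ n).dist_normed_convolution_le (μ := volume) (g := w) (x₀ := x) (ε := Λ * (φ n).rOut)
      hc.aestronglyMeasurable (fun y hy => by
        rw [Real.dist_eq]
        refine (hΛ y x).trans ?_
        rw [← dist_eq_norm]
        exact mul_le_mul_of_nonneg_left (mem_ball.1 hy).le hΛ0)
    rwa [Real.dist_eq] at this
  have ηi : ∀ n x, Integrable (fun t => (φ n).normed volume t * w (x - t)) := fun n x => by
    refine Continuous.integrable_of_hasCompactSupport ?_ ?_
    · exact (φ n).continuous_normed.mul (by fun_prop)
    · exact (φ n).hasCompactSupport_normed.mul_right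
  have ηL : ∀ n x y, |η n x - η n y| ≤ Λ * ‖x - y‖ := fun n x y => by
    rw [ηdef, ηdef, ← integral_sub (ηi n x) (ηi n y)]
    have hi : Integrable (fun t => (φ n).normed volume t * (Λ * ‖x - y‖)) :=
      (φ n).integrable_normed.mul_const _
    calc |∫ t, ((φ n).normed volume t * w (x - t) - (φ n).normed volume t * w (y - t))|
        ≤ ∫ t, (φ n).normed volume t * (Λ * ‖x - y‖) := by
          rw [← Real.norm_eq_abs]
          refine norm_integral_le_of_norm_le hi (ae_of_all _ fun t => ?_)
          rw [← mul_sub, norm_mul, Real.norm_eq_abs, Real.norm_eq_abs,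
            abs_of_nonneg ((φ n).nonneg_normed t)]
          refine mul_le_mul_of_nonneg_left ?_ ((φ n).nonneg_normed t)
          simpa using hΛ (x - t) (y - t)
      _ = _ := by rw [integral_mul_const, (φ n).integral_normed, one_mul]
  have ηM : ∀ n x, |η n x| ≤ M + Λ := fun n x => by
    have h1 := ηd n x
    have h2 := hM x
    have h3 : Λ * (1/((n:ℝ)+1)) ≤ Λ := mul_le_of_le_one_right hΛ0 (hrout1 n)
    have h4 : |η n x| ≤ |η n x - w x| + |w x| := by
      simpa using abs_add_le (η n x - w x) (w x)
    linarith
  have ηR : ∀ n x, R + 1 < ‖x‖ → η n x = 0 := fun n x hx => by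
    rw [ηdef]
    refine integral_eq_zero_of_ae (ae_of_all _ fun t => ?_)
    by_cases ht : ‖t‖ < (φ n).rOut
    · have : R < ‖x - t‖ := by
        have := norm_sub_norm_le x t
        linarith [hrout1 n]
      simp [hR _ this]
    · have : t ∉ Function.support ((φ n).normed volume) := by
        rw [(φ n).support_normed_eq]; simpa using ht
      have := Function.notMem_support.1 this
      simp [this]
  have ηlim : ∀ x, Filter.Tendsto (fun n => η n x) Filter.atTop (nhds (w x)) := fun x => by
    rw [tendsto_iff_dist_tendsto_zero]
    refine squeeze_zero (fun _ => dist_nonneg) (g := fun n : ℕ => Λ * (1/((n:ℝ)+1))) (fun n => ηd n x) ?_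
    simpa using tendsto_one_div_add_atTop_nhds_zero_nat.const_mul Λ
  have key : ∀ n, ∫ x, q x * (η n x)^2 ≤
      c / 2 * ∫ p : E2 × E2, (η n p.1 - η n (p.1 + p.2))^2 * K s p.2 := fun n => by
    have := hst (η n) (ηsm n) (ηc n)
    rwa [iter_eq (fun x y => (η n x - η n y)^2) (lipint h0 h1 (ηL n) (ηM n) (ηR n) (ηsm n).continuous)] at this
  refine le_of_tendsto_of_tendsto' ?_ ?_ key (b := Filter.atTop)
  · refine tendsto_integral_of_dominated_convergence
      (fun x => |q x| * ((M+Λ)^2) * ind (R+1) x) ?_ ?_ ?_ ?_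
    · intro n
      apply Continuous.aestronglyMeasurable
      have := (ηsm n).continuous
      fun_prop
    · have : (fun x => |q x| * ((M+Λ)^2) * ind (R+1) x) =
        (closedBall (0:E2) (R+1)).indicator (fun x => |q x| * ((M+Λ)^2)) := by
          ext x; simp [ind, indicator]
      rw [this, integrable_indicator_iff measurableSet_closedBall]
      exact (Continuous.continuousOn (by fun_prop)).integrableOn_compact (isCompact_closedBall _ _)
    · intro n
      refine ae_of_all _ fun x => ?_
      by_cases hx : ‖x‖ ≤ R+1
      · rw [ind_of hx, mul_one, norm_mul, Real.norm_eq_abs, Real.norm_eq_abs, abs_pow]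
        gcongr
        exact ηM n x
      · rw [ηR n x (not_le.1 hx), ind_of_not hx]; simp
    · exact ae_of_all _ fun x => ((ηlim x).pow 2).const_mul _
  · refine Filter.Tendsto.const_mul _ ?_
    refine tendsto_integral_of_dominated_convergence
      (fun p => ((Λ^2 + 4*(M+Λ)^2) * min 1 (‖p.2‖^2) * (ind (R+1) p.1 + ind (R+1) (p.1 + p.2))) * K s p.2) ?_ ?_ ?_ ?_
    · intro n
      exact (lipint h0 h1 (ηL n) (ηM n) (ηR n) (ηsm n).continuous).aestronglyMeasurable
    · refine dom h0 h1 (R+1) (Λ^2 + 4*(M+Λ)^2) _ ?_ ?_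
      · have := ind_meas (R+1)
        apply Measurable.aestronglyMeasurable
        fun_prop
      · intro p
        rw [abs_of_nonneg]
        have := ind_nonneg (R+1) p.1
        have := ind_nonneg (R+1) (p.1+p.2)
        positivity
    · intro n
      refine ae_of_all _ fun p => ?_
      rw [Real.norm_eq_abs, abs_mul, abs_of_nonneg (K_nonneg _ _)]
      exact mul_le_mul_of_nonneg_right (lipdom (ηL n) (ηM n) (ηR n) p) (K_nonneg _ _)
    · exact ae_of_all _ fun p => (((ηlim _).sub (ηlim _)).pow 2).mul_const _
end FL


namespace FL
lemma sd_bound {F : E2 → ℝ} (hF : ContDiff ℝ 2 F) (hb : ∀ x, |F x| ≤ 1) (R : ℝ) :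
    ∃ M, 0 ≤ M ∧ ∀ x z : E2, ‖x‖ ≤ R → |2 * F x - F (x+z) - F (x-z)| ≤ M * min 1 (‖z‖^2) := by
  have hF1 : ContDiff ℝ 1 (fderiv ℝ F) := hF.fderiv_right (by norm_num)
  obtain ⟨M, hM⟩ := (isCompact_closedBall (0:E2) (R+1)).exists_bound_of_continuousOn
    (hF1.continuous_fderiv (by norm_num)).continuousOn
  refine ⟨|M| + 4, by positivity, fun x z hx => ?_⟩
  have h4 : |2 * F x - F (x+z) - F (x-z)| ≤ 4 := by
    have h1 := abs_le.1 (hb x)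
    have h2 := abs_le.1 (hb (x+z))
    have h3 := abs_le.1 (hb (x-z))
    rw [abs_le]; constructor <;> linarith
  have hM0 := abs_nonneg M
  by_cases hz : ‖z‖ ≤ 1
  · have : min 1 (‖z‖^2) = ‖z‖^2 := min_eq_right (by nlinarith [norm_nonneg z])
    rw [this]
    refine (second_diff hF (M := |M|) ?_).trans (by nlinarith [sq_nonneg ‖z‖])
    intro y hy
    refine (hM y ?_).trans (le_abs_self M)
    rw [mem_closedBall, dist_eq_norm] at hy
    rw [mem_closedBall, dist_zero_right]
    have := norm_sub_norm_le y x
    linarith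
  · have : min 1 (‖z‖^2) = 1 := min_eq_left (by nlinarith [norm_nonneg z])
    rw [this]; linarith

lemma fd_bound {F : E2 → ℝ} (hF : ContDiff ℝ 1 F) (hb : ∀ x, |F x| ≤ 1) (R : ℝ) :
    ∃ M, 0 ≤ M ∧ ∀ x z : E2, ‖x‖ ≤ R → (F x - F (x+z))^2 ≤ M * min 1 (‖z‖^2) := by
  obtain ⟨M, hM⟩ := (isCompact_closedBall (0:E2) (R+1)).exists_bound_of_continuousOn
    (hF.continuous_fderiv (by norm_num)).continuousOn
  refine ⟨M^2 + 4, by positivity, fun x z hx => ?_⟩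
  have h1 := abs_le.1 (hb x)
  have h2 := abs_le.1 (hb (x+z))
  have h4 : (F x - F (x+z))^2 ≤ 4 := by nlinarith
  by_cases hz : ‖z‖ ≤ 1
  · have : min 1 (‖z‖^2) = ‖z‖^2 := min_eq_right (by nlinarith [norm_nonneg z])
    rw [this]
    have hsub : closedBall x ‖z‖ ⊆ closedBall 0 (R+1) := by
      intro y hy
      rw [mem_closedBall, dist_eq_norm] at hy
      rw [mem_closedBall, dist_zero_right]
      have := norm_sub_norm_le y x
      linarith
    have := (convex_closedBall x ‖z‖).norm_image_sub_le_of_norm_fderiv_le (𝕜 := ℝ) (f := F)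
      (fun w _ => (hF.differentiable (by norm_num)).differentiableAt) (fun w hw => hM w (hsub hw))
      (x := x + z) (y := x) (by simp) (by simp)
    simp only [sub_add_cancel_left, norm_neg, Real.norm_eq_abs] at this
    have h5 : (F x - F (x+z))^2 ≤ (M * ‖z‖)^2 := by
      rw [← sq_abs]; gcongr
    nlinarith [sq_nonneg ‖z‖]
  · have : min 1 (‖z‖^2) = 1 := min_eq_left (by nlinarith [norm_nonneg z])
    rw [this]; nlinarith

lemma cs_of {X : Type*} [TopologicalSpace X] {f g : X → ℝ} (hg : HasCompactSupport g)
    (h : ∀ x, g x = 0 → f x = 0) : HasCompactSupport f :=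
  hg.mono (fun x hx hg0 => hx (h x hg0))

lemma cs_of2 {X : Type*} [TopologicalSpace X] [R1Space X] {f g k : X → ℝ} (hg : HasCompactSupport g)
    (hk : HasCompactSupport k)
    (h : ∀ x, g x = 0 → k x = 0 → f x = 0) : HasCompactSupport f := by
  refine HasCompactSupport.intro (K := tsupport g ∪ tsupport k) (hg.isCompact.union hk.isCompact) ?_
  intro x hx
  simp only [mem_union, not_or] at hx
  exact h x (image_eq_zero_of_notMem_tsupport hx.1) (image_eq_zero_of_notMem_tsupport hx.2)

section
variable {u ζ : E2 → ℝ} {e : E2}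

/-- directional derivative -/
noncomputable def dd (e : E2) (u : E2 → ℝ) (x : E2) : ℝ := fderiv ℝ u x e

lemma dd_contDiff {n : ℕ} {u : E2 → ℝ} (hu : ContDiff ℝ (n+1) u) (e : E2) : ContDiff ℝ n (dd e u) :=
  (hu.fderiv_right le_rfl).clm_apply contDiff_const

lemma dd_c1 (hu : ContDiff ℝ 2 u) (e : E2) : ContDiff ℝ 1 (dd e u) :=
  (hu.fderiv_right (by norm_num)).clm_apply contDiff_const
lemma dd_c0 (hu : ContDiff ℝ 1 u) (e : E2) : Continuous (dd e u) :=
  (hu.continuous_fderiv (by norm_num)).clm_apply continuous_const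

lemma dd_compact (hu : HasCompactSupport u) (e : E2) : HasCompactSupport (dd e u) :=
  hu.fderiv_apply (𝕜 := ℝ) e

lemma ibp {a h : E2 → ℝ} (ha : ContDiff ℝ 1 a) (hh : ContDiff ℝ 1 h) (hc : HasCompactSupport h)
    (e : E2) : ∫ x, dd e a x * h x = - ∫ x, a x * dd e h x := by
  have h1 := int_fderiv_zero volume (ha.mul hh) hc.mul_left e
  have h2 : ∀ x, fderiv ℝ (fun y => a y * h y) x e = dd e a x * h x + a x * dd e h x := fun x => by
    rw [fderiv_fun_mul (ha.differentiable (by norm_num) x) (hh.differentiable (by norm_num) x)]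
    simp [dd]; ring
  simp_rw [h2] at h1
  have := dd_c0 ha e
  have := dd_c0 hh e
  have := ha.continuous
  have := hh.continuous
  rw [integral_add] at h1
  · linarith
  · exact Continuous.integrable_of_hasCompactSupport (by fun_prop) hc.mul_left
  · exact Continuous.integrable_of_hasCompactSupport (by fun_prop) (dd_compact hc e).mul_left

lemma dd_shift (u : E2 → ℝ) (e z x : E2) : dd e (fun y => u (y + z)) x = dd e u (x+z) := by
  simp [dd, fderiv_comp_add_right]

lemma perz (hu : ContDiff ℝ 2 u) (hζ : ContDiff ℝ 2 ζ) (hc : HasCompactSupport ζ) (e z : E2) :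
    ∫ x, ((ζ x * dd e u x - ζ (x+z) * dd e u (x+z))^2 +
      (2 * u x - u (x+z) - u (x-z)) * dd e (fun y => ζ y^2 * dd e u y) x) =
    ∫ x, dd e u x * dd e u (x+z) * (ζ x - ζ (x+z))^2 := by
  set v := dd e u with hv
  have hv1 : ContDiff ℝ 1 v := dd_c1 hu e
  have hvc := hv1.continuous
  have huc := hu.continuous
  have hζc := hζ.continuous
  set h : E2 → ℝ := fun y => ζ y^2 * v y with hh
  have hζ1 : ContDiff ℝ 1 ζ := hζ.of_le (by norm_num)
  have hu1 : ContDiff ℝ 1 u := hu.of_le (by norm_num)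
  have h1 : ContDiff ℝ 1 h := (hζ1.pow 2).mul hv1
  have hcz : HasCompactSupport (fun y => ζ y^2) := cs_of hc (by simp +contextual)
  have hhc : HasCompactSupport h := hcz.mul_right
  have hhcont := h1.continuous
  set φ := dd e h with hφ
  have hφc : Continuous φ := dd_c0 h1 e
  have hφs : HasCompactSupport φ := dd_compact hhc e
  have shs : ∀ {g : E2 → ℝ}, HasCompactSupport g → HasCompactSupport (fun x => g (x+z)) := by
    intro g hg
    exact hg.comp_homeomorph (Homeomorph.addRight z)
  have I : ∀ {g : E2 → ℝ}, Continuous g → HasCompactSupport g → Integrable g := fun a b =>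
    a.integrable_of_hasCompactSupport b
  have e1 := ibp (a := u) hu1 h1 hhc e
  have e2 := ibp (a := fun y => u (y + z)) (by fun_prop) h1 hhc e
  have e3 := ibp (a := fun y => u (y - z)) (by fun_prop) h1 hhc e
  simp_rw [dd_shift] at e2
  simp_rw [sub_eq_add_neg, dd_shift, ← sub_eq_add_neg] at e3
  have e4 : ∫ x, v (x - z) * h x = ∫ x, v x * h (x+z) := by
    rw [← integral_add_right_eq_self _ z]; simp
  have e5 : ∫ x, v x * h x = ∫ x, v (x+z) * h (x+z) := by
    rw [← integral_add_right_eq_self _ z]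
  have L : ∫ x, (2 * u x - u (x+z) - u (x-z)) * φ x =
      - ∫ x, (v x - v (x+z)) * (h x - h (x+z)) := by
    have a1 : ∀ x, (2 * u x - u (x+z) - u (x-z)) * φ x =
      2 * (u x * φ x) - u (x+z) * φ x - u (x-z) * φ x := fun x => by ring
    have a2 : ∀ x, (v x - v (x+z)) * (h x - h (x+z)) =
      v x * h x - v (x+z) * h x - v x * h (x+z) + v (x+z) * h (x+z) := fun x => by ring
    simp_rw [a1, a2]
    have i1 : Integrable (fun x => u x * φ x) := I (by fun_prop) hφs.mul_left
    have i2 : Integrable (fun x => u (x+z) * φ x) := I (by fun_prop) hφs.mul_left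
    have i3 : Integrable (fun x => u (x-z) * φ x) := I (by fun_prop) hφs.mul_left
    have j1 : Integrable (fun x => v x * h x) := I (by fun_prop) hhc.mul_left
    have j2 : Integrable (fun x => v (x+z) * h x) := I (by fun_prop) hhc.mul_left
    have j3 : Integrable (fun x => v x * h (x+z)) := I (by fun_prop) (shs hhc).mul_left
    have j4 : Integrable (fun x => v (x+z) * h (x+z)) := I (by fun_prop) (shs hhc).mul_left
    have i12 : Integrable (fun x => 2 * (u x * φ x) - u (x+z) * φ x) := (i1.const_mul 2).sub i2
    have j12 : Integrable (fun x => v x * h x - v (x+z) * h x) := j1.sub j2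
    have j123 : Integrable (fun x => v x * h x - v (x+z) * h x - v x * h (x+z)) := j12.sub j3
    rw [integral_sub i12 i3, integral_sub (i1.const_mul 2) i2,
      integral_const_mul, integral_add j123 j4, integral_sub j12 j3,
      integral_sub j1 j2]
    linarith
  have wI : Integrable (fun x => (ζ x * v x - ζ (x+z) * v (x+z))^2) := by
    refine I (by fun_prop) ?_
    exact cs_of2 hc (shs hc) (by simp +contextual)
  have pI : Integrable (fun x => (v x - v (x+z)) * (h x - h (x+z))) :=
    I (by fun_prop) (cs_of2 hhc (shs hhc) (by simp +contextual))
  have qI : Integrable (fun x => (2 * u x - u (x+z) - u (x-z)) * φ x) :=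
    I (by fun_prop) hφs.mul_left
  rw [integral_add wI qI, L, ← sub_eq_add_neg, ← integral_sub wI pI]
  congr 1; ext x; simp only [hh]; ring
end
end FL


namespace FL

lemma cs_ball {w : E2 → ℝ} (h : HasCompactSupport w) : ∃ R, ∀ x, R < ‖x‖ → w x = 0 := by
  obtain ⟨R, hR⟩ := h.isCompact.isBounded.subset_closedBall (0:E2)
  refine ⟨R, fun x hx => ?_⟩
  by_contra hne
  have := hR (subset_tsupport _ (Function.mem_support.2 hne))
  rw [mem_closedBall, dist_zero_right] at this
  linarith

lemma stageD {s : ℝ} (h0 : 0 < s) (h1 : s < 1) {c : ℝ} (hc0 : 0 < c) {u q F ζ : E2 → ℝ}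
    (hu : ContDiff ℝ 2 u) (hub : ∀ x, |u x| ≤ 1) (hq : Continuous q) (hF : ContDiff ℝ 1 F)
    (e : E2) (hFq : ∀ x, dd e F x = q x * dd e u x)
    (heq : ∀ x, c / 2 * ∫ y, (2 * u x - u (x+y) - u (x-y)) * K s y = F x)
    (hst : ∀ η : E2 → ℝ, ContDiff ℝ (⊤ : ℕ∞) η → HasCompactSupport η →
      ∫ x, q x * (η x)^2 ≤ c / 2 * ∫ x : E2, ∫ y : E2, (η x - η y)^2 / ‖x - y‖ ^ (((2:ℕ):ℝ) + 2*s))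
    (hζ : ContDiff ℝ 2 ζ) (hc : HasCompactSupport ζ) :
    Integrable (fun p : E2 × E2 => (|ζ p.1 * dd e u p.1 * (ζ (p.1+p.2) * dd e u (p.1+p.2))|
        - ζ p.1 * dd e u p.1 * (ζ (p.1+p.2) * dd e u (p.1+p.2))) * K s p.2) ∧
    Integrable (fun z => (∫ x, dd e u x * dd e u (x+z) * (ζ x - ζ (x+z))^2) * K s z) ∧
    2 * ∫ p : E2 × E2, (|ζ p.1 * dd e u p.1 * (ζ (p.1+p.2) * dd e u (p.1+p.2))|
        - ζ p.1 * dd e u p.1 * (ζ (p.1+p.2) * dd e u (p.1+p.2))) * K s p.2 ≤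
      ∫ z, (∫ x, dd e u x * dd e u (x+z) * (ζ x - ζ (x+z))^2) * K s z := by
  set v := dd e u with hv
  have hv1 : ContDiff ℝ 1 v := dd_c1 hu e
  have hvc := hv1.continuous
  have huc := hu.continuous
  have hζc := hζ.continuous
  set h : E2 → ℝ := fun y => ζ y^2 * v y with hh
  have hζ1 : ContDiff ℝ 1 ζ := hζ.of_le (by norm_num)
  have hh1 : ContDiff ℝ 1 h := (hζ1.pow 2).mul hv1
  have hhc : HasCompactSupport h := cs_of hc (by simp +contextual [hh])
  set φ := dd e h with hφ
  have hφc : Continuous φ := dd_c0 hh1 e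
  have hφs : HasCompactSupport φ := dd_compact hhc e
  set w : E2 → ℝ := fun y => ζ y * v y with hw
  have hw1 : ContDiff ℝ 1 w := hζ1.mul hv1
  have hwc : Continuous w := hw1.continuous
  have hws : HasCompactSupport w := cs_of hc (by simp +contextual [hw])
  obtain ⟨Λ, hΛ⟩ := hw1.lipschitzWith_of_hasCompactSupport hws (by norm_num)
  have hΛ1 : ∀ x y, |w x - w y| ≤ Λ * ‖x - y‖ := fun x y => by
    have := hΛ.dist_le_mul x y
    rwa [Real.dist_eq, dist_eq_norm] at this
  have hΛ2 : ∀ x y, |(|w x|) - (|w y|)| ≤ Λ * ‖x - y‖ := fun x y =>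
    (abs_abs_sub_abs_le _ _).trans (hΛ1 x y)
  obtain ⟨M, hM⟩ := hwc.bounded_above_of_compact_support hws
  have hM1 : ∀ x, |w x| ≤ M := hM
  have hM2 : ∀ x, |(|w x|)| ≤ M := fun x => by rw [abs_abs]; exact hM x
  obtain ⟨R, hR⟩ := cs_ball hws
  have hR2 : ∀ x, R < ‖x‖ → |w x| = 0 := fun x hx => by simp [hR x hx]
  -- integrability
  have I1 := lipint h0 h1 hΛ1 hM1 hR hwc
  have I3 := lipint h0 h1 hΛ2 hM2 hR2 hwc.abs
  have I2 : Integrable (fun p : E2 × E2 => ((2 * u p.1 - u (p.1+p.2) - u (p.1-p.2)) * φ p.1) * K s p.2) := by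
    obtain ⟨R', hR'⟩ := cs_ball hφs
    obtain ⟨M', hM'0, hM'⟩ := sd_bound hu hub R'
    obtain ⟨N, hN⟩ := hφc.bounded_above_of_compact_support hφs
    have hN0 : 0 ≤ N := (norm_nonneg _).trans (hN 0)
    refine dom h0 h1 R' (M' * N) _ (Continuous.aestronglyMeasurable (by fun_prop)) ?_
    rintro ⟨x, z⟩
    simp only
    by_cases hx : ‖x‖ ≤ R'
    · rw [abs_mul]
      calc _ ≤ (M' * min 1 (‖z‖^2)) * N := by
            refine mul_le_mul (hM' x z hx) (hN x) (abs_nonneg _) (by positivity)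
        _ = (M' * N * min 1 (‖z‖^2)) := by ring
        _ ≤ _ := le_mul_of_one_le_right (by positivity) (by
            rw [ind_of hx]; linarith [ind_nonneg R' (x+z)])
    · rw [hR' x (not_le.1 hx)]
      have := ind_nonneg R' x
      have := ind_nonneg R' (x+z)
      simp only [mul_zero, abs_zero]; positivity
  have hstab := stab_lip h0 h1 hq hst hΛ2 hM2 hR2 hwc.abs
  have e1 : ∫ x, q x * |w x|^2 = - ∫ x, F x * φ x := by
    rw [← ibp hF hh1 hhc e]
    congr 1; ext x; rw [hFq, sq_abs]; simp only [hw, hh]; ring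
  have e2 : ∫ x, F x * φ x = c / 2 *
      ∫ p : E2 × E2, ((2 * u p.1 - u (p.1+p.2) - u (p.1-p.2)) * φ p.1) * K s p.2 := by
    rw [Measure.volume_eq_prod, integral_prod _ (by rwa [← Measure.volume_eq_prod]),
      ← integral_const_mul]
    congr 1; ext x
    rw [← heq x, mul_assoc, ← integral_mul_const]
    congr 2; ext y; ring
  have eI : ∀ p : E2 × E2, (|w p.1 * w (p.1+p.2)| - w p.1 * w (p.1+p.2)) * K s p.2 =
      1/2 * ((w p.1 - w (p.1+p.2))^2 * K s p.2 - (|w p.1| - |w (p.1+p.2)|)^2 * K s p.2) := by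
    intro p
    rw [abs_mul]
    have a := sq_abs (w p.1)
    have b := sq_abs (w (p.1+p.2))
    linear_combination (-(1/2) * K s p.2) * (-a - b)
  have I4 : Integrable (fun p : E2 × E2 => (|w p.1 * w (p.1+p.2)| - w p.1 * w (p.1+p.2)) * K s p.2) := by
    simp_rw [eI]
    exact (I1.sub I3).const_mul _
  have I5 : Integrable (fun p : E2 × E2 => ((w p.1 - w (p.1+p.2))^2 +
      (2 * u p.1 - u (p.1+p.2) - u (p.1-p.2)) * φ p.1) * K s p.2) := by
    simp_rw [add_mul]; exact I1.add I2
  have ez : ∀ z, ∫ x, ((w x - w (x+z))^2 + (2 * u x - u (x+z) - u (x-z)) * φ x) * K s z =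
      (∫ x, v x * v (x+z) * (ζ x - ζ (x+z))^2) * K s z := fun z => by
    rw [integral_mul_const, perz hu hζ hc e z]
  refine ⟨I4, ?_, ?_⟩
  · have := I5.integral_prod_right
    exact this.congr (ae_of_all _ fun z => ez z)
  · have e6 : ∫ p : E2 × E2, ((w p.1 - w (p.1+p.2))^2 +
      (2 * u p.1 - u (p.1+p.2) - u (p.1-p.2)) * φ p.1) * K s p.2 =
        ∫ z, (∫ x, v x * v (x+z) * (ζ x - ζ (x+z))^2) * K s z := by
      rw [Measure.volume_eq_prod, integral_prod_symm _ (by rwa [← Measure.volume_eq_prod])]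
      simp_rw [← ez]
    have e7 : ∫ p : E2 × E2, (|w p.1 * w (p.1+p.2)| - w p.1 * w (p.1+p.2)) * K s p.2 =
       1/2 * ((∫ p : E2 × E2, (w p.1 - w (p.1+p.2))^2 * K s p.2) - ∫ p : E2 × E2, (|w p.1| - |w (p.1+p.2)|)^2 * K s p.2) := by
      simp_rw [eI]
      rw [integral_const_mul, integral_sub I1 I3]
    rw [← e6]
    simp_rw [add_mul]
    rw [integral_add I1 I2, e7]
    rw [e1, e2] at hstab
    have : 0 ≤ c/2 * ((∫ p : E2 × E2, (|w p.1| - |w (p.1+p.2)|)^2 * K s p.2) +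
      ∫ p : E2 × E2, ((2 * u p.1 - u (p.1+p.2) - u (p.1-p.2)) * φ p.1) * K s p.2) := by
      linarith
    have := nonneg_of_mul_nonneg_right this (by positivity)
    linarith
end FL


namespace FL

noncomputable def ψ : ContDiffBump (0 : E2) := ⟨1, 2, by norm_num, by norm_num⟩

lemma ψ_cd : ContDiff ℝ 2 (ψ : E2 → ℝ) := ψ.contDiff
lemma ψ_cs : HasCompactSupport (ψ : E2 → ℝ) := ψ.hasCompactSupport

noncomputable def cut (ρ : ℝ) (x : E2) : ℝ := ψ (ρ⁻¹ • x)

lemma cut_cd (ρ : ℝ) : ContDiff ℝ 2 (cut ρ) := ψ_cd.comp (contDiff_const_smul _)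

lemma cut_zero {ρ : ℝ} (hρ : 0 < ρ) {x : E2} (h : 2 * ρ < ‖x‖) : cut ρ x = 0 := by
  refine ψ.zero_of_le_dist ?_
  rw [dist_zero_right, norm_smul, norm_inv, Real.norm_eq_abs, abs_of_pos hρ]
  show 2 ≤ ρ⁻¹ * ‖x‖
  rw [inv_mul_eq_div, le_div_iff₀ hρ]; linarith

lemma cut_one {ρ : ℝ} (hρ : 0 < ρ) {x : E2} (h : ‖x‖ ≤ ρ) : cut ρ x = 1 := by
  refine ψ.one_of_mem_closedBall ?_
  rw [mem_closedBall, dist_zero_right, norm_smul, norm_inv, Real.norm_eq_abs, abs_of_pos hρ]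
  show ρ⁻¹ * ‖x‖ ≤ 1
  rw [inv_mul_eq_div, div_le_one hρ]; linarith

lemma cut_nonneg (ρ : ℝ) (x : E2) : 0 ≤ cut ρ x := ψ.nonneg
lemma cut_le_one (ρ : ℝ) (x : E2) : cut ρ x ≤ 1 := ψ.le_one

lemma cut_cs {ρ : ℝ} (hρ : 0 < ρ) : HasCompactSupport (cut ρ) :=
  HasCompactSupport.intro (isCompact_closedBall (0:E2) (2*ρ))
    (fun x hx => cut_zero hρ (by simpa using hx))

lemma ψ_sd : ∃ M, 0 ≤ M ∧ ∀ x z : E2, |2 * ψ x - ψ (x+z) - ψ (x-z)| ≤ M * min 1 (‖z‖^2) := by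
  have h1 : ContDiff ℝ 1 (fderiv ℝ (ψ : E2 → ℝ)) := ψ_cd.fderiv_right (by norm_num)
  obtain ⟨M, hM⟩ := (h1.continuous_fderiv (by norm_num)).bounded_above_of_compact_support
    ((ψ_cs.fderiv (𝕜 := ℝ)).fderiv (𝕜 := ℝ))
  refine ⟨|M| + 4, by positivity, fun x z => ?_⟩
  have a := second_diff ψ_cd (M := |M|) (x := x) (z := z) (fun y _ => (hM y).trans (le_abs_self M))
  have b : |2 * ψ x - ψ (x+z) - ψ (x-z)| ≤ 4 := by
    have h1 := ψ.nonneg' x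
    have h2 := ψ.nonneg' (x+z)
    have h3 := ψ.nonneg' (x-z)
    have g1 := ψ.le_one (x := x)
    have g2 := ψ.le_one (x := x+z)
    have g3 := ψ.le_one (x := x-z)
    rw [abs_le]; constructor <;> linarith
  have := abs_nonneg M
  rcases min_cases 1 (‖z‖^2) with ⟨h, _⟩ | ⟨h, _⟩ <;> rw [h]
  · linarith
  · nlinarith [sq_nonneg ‖z‖]

lemma int_ind {R : ℝ} (hR : 0 ≤ R) : ∫ x, ind R x = R^2 * volume.real (ball (0:E2) 1) := by
  unfold ind
  rw [integral_indicator measurableSet_closedBall]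
  simp [Measure.addHaar_real_closedBall _ _ hR]

lemma en_int {s : ℝ} (h0 : 0 < s) (h1 : s < 1) {u : E2 → ℝ}
    (hu : ContDiff ℝ 2 u) (hub : ∀ x, |u x| ≤ 1) (R : ℝ) :
    Integrable (fun p : E2 × E2 => ind R p.1 * (u p.1 - u (p.1+p.2))^2 * K s p.2) := by
  obtain ⟨M, hM0, hM⟩ := fd_bound (hu.of_le (by norm_num)) hub R
  have hi := ind_meas R
  have huc := hu.continuous.measurable
  refine dom h0 h1 R M _ (Measurable.aestronglyMeasurable (by fun_prop)) ?_
  rintro ⟨x, z⟩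
  have i1 := ind_nonneg R x
  have i2 := ind_nonneg R (x+z)
  simp only
  rw [abs_of_nonneg (by positivity)]
  by_cases hx : ‖x‖ ≤ R
  · rw [ind_of hx, one_mul]
    exact (hM x z hx).trans (le_mul_of_one_le_right (by positivity) (by linarith))
  · rw [ind_of_not hx, zero_mul]; positivity

lemma cacc {s : ℝ} (h0 : 0 < s) (h1 : s < 1) {c : ℝ} (hc0 : 0 < c) {u F : E2 → ℝ}
    (hu : ContDiff ℝ 2 u) (hub : ∀ x, |u x| ≤ 1) (hF : Continuous F)
    {MF : ℝ} (hMF : ∀ x, |F x| ≤ MF)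
    (heq : ∀ x, c / 2 * ∫ y, (2 * u x - u (x+y) - u (x-y)) * K s y = F x) :
    ∃ C, 0 ≤ C ∧ ∀ ρ, 1 ≤ ρ →
      ∫ p : E2 × E2, ind ρ p.1 * (u p.1 - u (p.1+p.2))^2 * K s p.2 ≤ C * ρ^2 := by
  obtain ⟨M, hM0, hM⟩ := ψ_sd
  have hMF0 : 0 ≤ MF := (abs_nonneg _).trans (hMF 0)
  set V := volume.real (ball (0:E2) 1) with hV
  have hV0 : 0 ≤ V := measureReal_nonneg
  have hm0 : 0 ≤ ∫ z, mK s z := integral_nonneg (mK_nonneg s)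
  refine ⟨(4 / c * MF) * (4 * V) + 3 * M * (4 * V) * ∫ z, mK s z, by positivity, fun ρ hρ => ?_⟩
  have hρ0 : 0 < ρ := by linarith
  set ζ := cut ρ with hζ
  have hζc : Continuous ζ := (cut_cd ρ).continuous
  have huc := hu.continuous
  have hind : ∀ x, ζ x ≤ ind (2*ρ) x := fun x => by
    by_cases hx : ‖x‖ ≤ 2*ρ
    · rw [ind_of hx]; exact cut_le_one ρ x
    · rw [ind_of_not hx, hζ, cut_zero hρ0 (not_le.1 hx)]
  have hζsd : ∀ x z, |2 * ζ x - ζ (x+z) - ζ (x-z)| ≤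
      M * min 1 (‖z‖^2) * (ind (2*ρ) x + ind (2*ρ) (x+z) + ind (2*ρ) (x-z)) := fun x z => by
    have a := hM (ρ⁻¹ • x) (ρ⁻¹ • z)
    rw [← smul_add, ← smul_sub] at a
    have b : min 1 (‖ρ⁻¹ • z‖^2) ≤ min 1 (‖z‖^2) := by
      apply min_le_min_left
      gcongr
      rw [norm_smul, norm_inv, Real.norm_eq_abs, abs_of_pos hρ0]
      exact mul_le_of_le_one_left (norm_nonneg _) (inv_le_one_of_one_le₀ hρ)
    have a' : |2 * ζ x - ζ (x+z) - ζ (x-z)| ≤ M * min 1 (‖z‖^2) :=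
      a.trans (mul_le_mul_of_nonneg_left b hM0)
    have i1 := ind_nonneg (2*ρ) x
    have i2 := ind_nonneg (2*ρ) (x+z)
    have i3 := ind_nonneg (2*ρ) (x-z)
    have hp : 0 ≤ M * min 1 (‖z‖^2) := by positivity
    by_cases hx : ‖x‖ ≤ 2*ρ
    · exact a'.trans (le_mul_of_one_le_right hp (by rw [ind_of hx]; linarith))
    by_cases hx2 : ‖x+z‖ ≤ 2*ρ
    · exact a'.trans (le_mul_of_one_le_right hp (by rw [ind_of hx2]; linarith))
    by_cases hx3 : ‖x-z‖ ≤ 2*ρ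
    · exact a'.trans (le_mul_of_one_le_right hp (by rw [ind_of hx3]; linarith))
    · rw [hζ, cut_zero hρ0 (not_le.1 hx), cut_zero hρ0 (not_le.1 hx2), cut_zero hρ0 (not_le.1 hx3)]
      simp only [mul_zero, sub_zero, abs_zero]; positivity
  set U : E2 → ℝ := fun x => u x^2 with hU
  have hUc : ContDiff ℝ 2 U := hu.pow 2
  have hUcont := hUc.continuous
  have hUb : ∀ x, |U x| ≤ 1 := fun x => by
    simp only [hU, abs_pow]; exact pow_le_one₀ (abs_nonneg _) (hub x)
  -- generic integrability
  have gI : ∀ (g a : E2 → ℝ), ContDiff ℝ 2 g → (∀ x, |g x| ≤ 1) → Continuous a → (∀ x, |a x| ≤ 1) →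
      Integrable (fun p : E2 × E2 => (ζ p.1 * a p.1 * (2 * g p.1 - g (p.1+p.2) - g (p.1-p.2))) * K s p.2) := by
    intro g a hg hgb ha hab
    obtain ⟨M', hM'0, hM'⟩ := sd_bound hg hgb (2*ρ)
    have := hg.continuous
    refine dom h0 h1 (2*ρ) M' _ (Continuous.aestronglyMeasurable (by fun_prop)) ?_
    rintro ⟨x, z⟩
    have i1 := ind_nonneg (2*ρ) x
    have i2 := ind_nonneg (2*ρ) (x+z)
    simp only
    by_cases hx : ‖x‖ ≤ 2*ρ
    · rw [abs_mul, abs_mul, abs_of_nonneg (cut_nonneg ρ x)]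
      have q1 : ζ x * |a x| ≤ 1 := mul_le_one₀ (cut_le_one ρ x) (abs_nonneg _) (hab x)
      have q2 := hM' x z hx
      calc _ ≤ 1 * (M' * min 1 (‖z‖^2)) := mul_le_mul q1 q2 (abs_nonneg _) zero_le_one
        _ = M' * min 1 (‖z‖^2) := one_mul _
        _ ≤ _ := le_mul_of_one_le_right (by positivity) (by rw [ind_of hx]; linarith)
    · rw [hζ, cut_zero hρ0 (not_le.1 hx)]
      simp only [zero_mul, abs_zero]; positivity
  have J1 := gI u u hu hub huc hub
  have J2 := gI U (fun _ => 1) hUc hUb continuous_const (by simp)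
  simp only [mul_one] at J2
  have step1 : ∫ p : E2 × E2, ind ρ p.1 * (u p.1 - u (p.1+p.2))^2 * K s p.2 ≤
      ∫ p : E2 × E2, (2 * ((ζ p.1 * u p.1 * (2 * u p.1 - u (p.1+p.2) - u (p.1-p.2))) * K s p.2) -
        (ζ p.1 * (2 * U p.1 - U (p.1+p.2) - U (p.1-p.2))) * K s p.2) := by
    refine integral_mono (en_int h0 h1 hu hub ρ) ((J1.const_mul 2).sub J2) ?_
    rintro ⟨x, z⟩
    simp only [hU]
    have hk := K_nonneg s z
    have hi : ind ρ x ≤ ζ x := by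
      by_cases hx : ‖x‖ ≤ ρ
      · rw [ind_of hx, hζ, cut_one hρ0 hx]
      · rw [ind_of_not hx]; exact cut_nonneg ρ x
    have q1 : ind ρ x * (u x - u (x+z))^2 * K s z ≤ ζ x * (u x - u (x+z))^2 * K s z := by gcongr
    have q2 : 0 ≤ ζ x * (u x - u (x-z))^2 * K s z := by
      have := cut_nonneg ρ x; positivity
    refine q1.trans ?_
    nlinarith
  have vind : ∫ x, ind (2*ρ) x = 4 * V * ρ^2 := by rw [int_ind (by positivity)]; ring
  have step2 : ∫ p : E2 × E2, (ζ p.1 * u p.1 * (2 * u p.1 - u (p.1+p.2) - u (p.1-p.2))) * K s p.2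
      ≤ (2/c * MF) * (4 * V * ρ^2) := by
    rw [Measure.volume_eq_prod, integral_prod _ (by rwa [← Measure.volume_eq_prod])]
    have : ∀ x, ∫ z, (ζ x * u x * (2 * u x - u (x+z) - u (x-z))) * K s z =
        2 / c * (ζ x * u x * F x) := fun x => by
      rw [← heq x]
      simp_rw [mul_assoc (ζ x * u x)]
      rw [integral_const_mul]; field_simp
    simp only [this]
    rw [← vind, ← integral_const_mul]
    have hint : Integrable (fun x => 2 / c * (ζ x * u x * F x)) := by
      refine Integrable.const_mul ?_ _
      refine Continuous.integrable_of_hasCompactSupport (by fun_prop) ?_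
      exact ((cut_cs hρ0).mul_right (f' := u)).mul_right (f' := F)
    refine integral_mono hint ((ind_integrable _).const_mul _) fun x => ?_
    have z0 := cut_nonneg ρ x
    have : ζ x * u x * F x ≤ MF * ind (2*ρ) x := by
      refine (le_abs_self _).trans ?_
      rw [abs_mul, abs_mul, abs_of_nonneg (show 0 ≤ ζ x from z0)]
      calc _ ≤ ind (2*ρ) x * 1 * MF := by
            gcongr
            · rw [mul_one]; exact ind_nonneg _ _
            · exact ind_nonneg _ _
            · exact hind x
            · exact hub x
            · exact hMF x
        _ = _ := by ring
    calc _ ≤ 2 / c * (MF * ind (2*ρ) x) := by gcongr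
      _ = _ := by ring
  have step3 : |∫ p : E2 × E2, (ζ p.1 * (2 * U p.1 - U (p.1+p.2) - U (p.1-p.2))) * K s p.2|
      ≤ 3 * M * (4 * V * ρ^2) * ∫ z, mK s z := by
    rw [Measure.volume_eq_prod, integral_prod_symm _ (by rwa [← Measure.volume_eq_prod]),
      ← integral_const_mul, ← Real.norm_eq_abs]
    refine norm_integral_le_of_norm_le ((mK_integrable h0 h1).const_mul _) (ae_of_all _ fun z => ?_)
    have Iζ : ∀ g : E2 → ℝ, Continuous g → Integrable (fun x => ζ x * g x) := fun g hg =>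
      Continuous.integrable_of_hasCompactSupport (by fun_prop) (cut_cs hρ0).mul_right
    have e1 : ∫ x, ζ x * U (x+z) = ∫ x, ζ (x-z) * U x := by
      rw [← integral_sub_right_eq_self _ z]; simp
    have e2 : ∫ x, ζ x * U (x-z) = ∫ x, ζ (x+z) * U x := by
      rw [← integral_add_right_eq_self _ z]; simp
    have Ip : Integrable (fun x => ζ (x+z) * U x) := by
      have := (Iζ (fun x => U (x-z)) (by fun_prop)).comp_add_right z
      simpa using this
    have Im : Integrable (fun x => ζ (x-z) * U x) := by
      have := (Iζ (fun x => U (x+z)) (by fun_prop)).comp_sub_right z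
      simpa using this
    have I0 : Integrable (fun x => 2 * (ζ x * U x)) := (Iζ U hUcont).const_mul 2
    have Iap := Iζ (fun x => U (x+z)) (by fun_prop)
    have Iam := Iζ (fun x => U (x-z)) (by fun_prop)
    have e3 : ∫ x, ζ x * (2 * U x - U (x+z) - U (x-z)) = ∫ x, (2 * ζ x - ζ (x+z) - ζ (x-z)) * U x := by
      have a1 : ∀ x, ζ x * (2 * U x - U (x+z) - U (x-z)) =
        2 * (ζ x * U x) - ζ x * U (x+z) - ζ x * U (x-z) := fun x => by ring
      have a2 : ∀ x, (2 * ζ x - ζ (x+z) - ζ (x-z)) * U x =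
        2 * (ζ x * U x) - ζ (x+z) * U x - ζ (x-z) * U x := fun x => by ring
      simp only [a1, a2]
      have t1 : Integrable (fun x => 2 * (ζ x * U x) - ζ x * U (x+z)) := I0.sub Iap
      have t2 : Integrable (fun x => 2 * (ζ x * U x) - ζ (x+z) * U x) := I0.sub Ip
      rw [integral_sub t1 Iam, integral_sub I0 Iap, integral_sub t2 Im, integral_sub I0 Ip, e1, e2]
      ring
    show ‖∫ x, ζ x * (2 * U x - U (x+z) - U (x-z)) * K s z‖ ≤ _
    rw [integral_mul_const, e3, norm_mul, Real.norm_eq_abs (K s z), abs_of_nonneg (K_nonneg s z)]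
    have ii := ind_integrable (2*ρ)
    have j2 : Integrable (fun x => ind (2*ρ) (x+z)) := ii.comp_add_right z
    have j3 : Integrable (fun x => ind (2*ρ) (x-z)) := ii.comp_sub_right z
    have j12 : Integrable (fun x => ind (2*ρ) x + ind (2*ρ) (x+z)) := ii.add j2
    have j123 : Integrable (fun x => ind (2*ρ) x + ind (2*ρ) (x+z) + ind (2*ρ) (x-z)) := j12.add j3
    have b : ‖∫ x, (2 * ζ x - ζ (x+z) - ζ (x-z)) * U x‖ ≤ ∫ x, M * min 1 (‖z‖^2) *
        (ind (2*ρ) x + ind (2*ρ) (x+z) + ind (2*ρ) (x-z)) := by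
      refine norm_integral_le_of_norm_le (j123.const_mul _) (ae_of_all _ fun x => ?_)
      rw [norm_mul, Real.norm_eq_abs, Real.norm_eq_abs]
      exact (mul_le_of_le_one_right (abs_nonneg _) (hUb x)).trans (hζsd x z)
    rw [integral_const_mul, integral_add j12 j3, integral_add ii j2,
      integral_add_right_eq_self (ind (2*ρ)) z, integral_sub_right_eq_self (ind (2*ρ)) z, vind] at b
    refine (mul_le_mul_of_nonneg_right b (K_nonneg s z)).trans (le_of_eq ?_)
    unfold mK; ring
  refine step1.trans ?_
  rw [integral_sub (J1.const_mul 2) J2, integral_const_mul]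
  have := (abs_le.1 step3).1
  have e : (4 / c * MF) = 2 * (2/c*MF) := by ring
  rw [e]
  nlinarith

end FL


namespace FL

lemma hd {g : E2 → ℝ} (hg : Differentiable ℝ g) (y e : E2) :
    HasDerivAt (fun t : ℝ => g (y + t • e)) (dd e g y) 0 :=
  (hg y).hasFDerivAt.hasLineDerivAt e

lemma hd_at {g : E2 → ℝ} {y : E2} (hg : DifferentiableAt ℝ g y) (e : E2) :
    HasDerivAt (fun t : ℝ => g (y + t • e)) (dd e g y) 0 :=
  hg.hasFDerivAt.hasLineDerivAt e

noncomputable def χ : ContDiffBump (0 : ℝ) := ⟨1, 2, by norm_num, by norm_num⟩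

lemma χ_cd : ContDiff ℝ 2 (χ : ℝ → ℝ) := χ.contDiff

lemma χ_bd : ∃ X, 0 ≤ X ∧ (∀ t, |deriv (χ : ℝ → ℝ) t| ≤ X) ∧ (∀ t, |deriv (deriv (χ : ℝ → ℝ)) t| ≤ X) := by
  have c1 : ContDiff ℝ 1 (deriv (χ : ℝ → ℝ)) := ((contDiff_succ_iff_deriv (n := 1)).1 (by simpa [one_add_one_eq_two] using χ_cd)).2.2
  have s1 : HasCompactSupport (deriv (χ : ℝ → ℝ)) := χ.hasCompactSupport.deriv
  obtain ⟨X1, h1⟩ := c1.continuous.bounded_above_of_compact_support s1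
  obtain ⟨X2, h2⟩ := (c1.continuous_deriv (by norm_num)).bounded_above_of_compact_support s1.deriv
  refine ⟨max X1 X2, ?_, fun t => (h1 t).trans (le_max_left _ _), fun t => (h2 t).trans (le_max_right _ _)⟩
  exact ((norm_nonneg _).trans (h1 0)).trans (le_max_left _ _)

/-- one-dimensional profile -/
noncomputable def φ (a N τ : ℝ) : ℝ := Real.exp (-a * τ) * χ (τ / N)
noncomputable def φ1 (a N τ : ℝ) : ℝ := Real.exp (-a * τ) * (-a * χ (τ / N) + deriv (χ : ℝ → ℝ) (τ / N) / N)
noncomputable def φ2 (a N τ : ℝ) : ℝ := Real.exp (-a * τ) * (a ^ 2 * χ (τ / N)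
  - 2 * a * (deriv (χ : ℝ → ℝ) (τ / N) / N) + deriv (deriv (χ : ℝ → ℝ)) (τ / N) / N ^ 2)

lemma φ_hd (a N τ : ℝ) : HasDerivAt (φ a N) (φ1 a N τ) τ := by
  have h1 : HasDerivAt (fun t => Real.exp (-a * t)) (Real.exp (-a * τ) * (-a)) τ := by
    have := ((hasDerivAt_id τ).const_mul (-a)).exp
    simpa using this
  have h2 : HasDerivAt (fun t => (χ : ℝ → ℝ) (t / N)) (deriv (χ : ℝ → ℝ) (τ / N) * (1 / N)) τ :=
    HasDerivAt.comp (h₂ := (χ : ℝ → ℝ)) (h := fun t => t / N) τ ((χ_cd.differentiable (by norm_num)) (τ/N)).hasDerivAt ((hasDerivAt_id τ).div_const N)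
  refine (h1.mul h2).congr_deriv ?_
  unfold φ1; ring

lemma φ1_hd (a N τ : ℝ) : HasDerivAt (φ1 a N) (φ2 a N τ) τ := by
  have c1 : ContDiff ℝ 1 (deriv (χ : ℝ → ℝ)) := ((contDiff_succ_iff_deriv (n := 1)).1 (by simpa [one_add_one_eq_two] using χ_cd)).2.2
  have h1 : HasDerivAt (fun t => Real.exp (-a * t)) (Real.exp (-a * τ) * (-a)) τ := by
    have := ((hasDerivAt_id τ).const_mul (-a)).exp
    simpa using this
  have h2 : HasDerivAt (fun t => (χ : ℝ → ℝ) (t / N)) (deriv (χ : ℝ → ℝ) (τ / N) * (1 / N)) τ :=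
    HasDerivAt.comp (h₂ := (χ : ℝ → ℝ)) (h := fun t => t / N) τ ((χ_cd.differentiable (by norm_num)) (τ/N)).hasDerivAt ((hasDerivAt_id τ).div_const N)
  have h3 : HasDerivAt (fun t => deriv (χ : ℝ → ℝ) (t / N)) (deriv (deriv (χ : ℝ → ℝ)) (τ / N) * (1 / N)) τ :=
    HasDerivAt.comp (h₂ := deriv (χ : ℝ → ℝ)) (h := fun t => t / N) τ ((c1.differentiable (by norm_num)) (τ/N)).hasDerivAt ((hasDerivAt_id τ).div_const N)
  refine (h1.mul ((h2.const_mul (-a)).add (h3.div_const N))).congr_deriv ?_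
  unfold φ2; simp only [Pi.add_apply, div_eq_mul_inv]; ring

lemma φ_cd (a N : ℝ) : ContDiff ℝ 2 (φ a N) := by
  have := χ_cd
  unfold φ
  exact (Real.contDiff_exp.comp (contDiff_const.mul contDiff_id)).mul (χ_cd.comp (contDiff_id.div_const N))

lemma φ_bd {X : ℝ} (hX : 0 ≤ X) (h1 : ∀ t, |deriv (χ : ℝ → ℝ) t| ≤ X) (h2 : ∀ t, |deriv (deriv (χ : ℝ → ℝ)) t| ≤ X)
    {a N : ℝ} (ha : 0 ≤ a) (hN : 1 ≤ N) (τ : ℝ) :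
    |φ a N τ| ≤ Real.exp (-a * τ) ∧ |φ1 a N τ| ≤ Real.exp (-a * τ) * (a + X) ∧
    |φ2 a N τ| ≤ Real.exp (-a * τ) * (a ^ 2 + 2 * a * X + X) := by
  have e := (Real.exp_pos (-a * τ)).le
  have c0 : |(χ : ℝ → ℝ) (τ/N)| ≤ 1 := by rw [abs_of_nonneg χ.nonneg]; exact χ.le_one
  have d1 : |deriv (χ : ℝ → ℝ) (τ / N) / N| ≤ X := by
    rw [abs_div, abs_of_pos (by linarith : 0 < N)]
    exact (div_le_self (abs_nonneg _) hN).trans (h1 _)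
  have d2 : |deriv (deriv (χ : ℝ → ℝ)) (τ / N) / N ^ 2| ≤ X := by
    rw [abs_div, abs_of_pos (by positivity : 0 < N ^ 2)]
    exact (div_le_self (abs_nonneg _) (by nlinarith)).trans (h2 _)
  unfold φ φ1 φ2
  simp only [abs_mul (Real.exp _), abs_of_nonneg e]
  refine ⟨mul_le_of_le_one_right e c0, ?_, ?_⟩
  · refine mul_le_mul_of_nonneg_left ((abs_add_le _ _).trans (add_le_add ?_ d1)) e
    rw [abs_mul, abs_neg, abs_of_nonneg ha]; exact mul_le_of_le_one_right ha c0
  · refine mul_le_mul_of_nonneg_left ((abs_add_le _ _).trans (add_le_add ((abs_sub _ _).trans (add_le_add ?_ ?_)) d2)) e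
    · rw [abs_mul, abs_of_nonneg (by positivity)]; exact mul_le_of_le_one_right (by positivity) c0
    · rw [abs_mul, abs_of_nonneg (by positivity)]; exact mul_le_mul_of_nonneg_left d1 (by positivity)

open Classical in
noncomputable def kn (a N : ℝ) (z : E2) : ℝ := if z = 0 then 0 else φ a N (Real.log (‖z‖ ^ 2))

lemma φ_zero {a N τ : ℝ} (hN : 1 ≤ N) (h : 2 * N ≤ |τ|) : φ a N τ = 0 := by
  have : (χ : ℝ → ℝ) (τ / N) = 0 := by
    refine χ.zero_of_le_dist ?_
    rw [dist_zero_right, Real.norm_eq_abs, abs_div, abs_of_pos (by linarith : 0 < N)]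
    show 2 ≤ _
    rwa [le_div_iff₀ (by linarith)]
  simp [φ, this]

lemma kn_ev {a N : ℝ} {z : E2} (hz : z ≠ 0) : kn a N =ᶠ[nhds z] fun y => φ a N (Real.log (‖y‖ ^ 2)) := by
  filter_upwards [isOpen_ne.mem_nhds hz] with y hy
  simp [kn, show y ≠ 0 from hy]

lemma kn_cd {a N : ℝ} (hN : 1 ≤ N) : ContDiff ℝ 2 (kn a N) := by
  rw [contDiff_iff_contDiffAt]
  intro z
  by_cases hz : z = 0
  · subst hz
    have : kn a N =ᶠ[nhds 0] fun _ => 0 := by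
      filter_upwards [ball_mem_nhds (0:E2) (Real.exp_pos (-N))] with y hy
      by_cases h : y = 0
      · simp [kn, h]
      · simp only [kn, h, if_false]
        apply φ_zero hN
        rw [mem_ball, dist_zero_right] at hy
        have : Real.log ‖y‖ < -N := by
          rw [Real.log_lt_iff_lt_exp (norm_pos_iff.2 h)]; exact hy
        rw [Real.log_pow, abs_of_neg (by push_cast; linarith)]
        push_cast; linarith
    exact contDiffAt_const.congr_of_eventuallyEq this
  · refine ContDiffAt.congr_of_eventuallyEq ?_ (kn_ev hz)
    have h : ContDiffAt ℝ 2 (fun y : E2 => Real.log (‖y‖^2)) z :=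
      ((contDiff_norm_sq ℝ).contDiffAt).log (by simpa using hz)
    exact (φ_cd a N).contDiffAt.comp z h

lemma kn_cs {a N : ℝ} (hN : 1 ≤ N) : HasCompactSupport (kn a N) := by
  refine HasCompactSupport.intro (isCompact_closedBall (0:E2) (Real.exp N)) fun y hy => ?_
  rw [mem_closedBall, dist_zero_right, not_le] at hy
  by_cases h : y = 0
  · simp [kn, h]
  · simp only [kn, h, if_false]
    apply φ_zero hN
    have : N < Real.log ‖y‖ := (Real.lt_log_iff_exp_lt (norm_pos_iff.2 h)).2 hy
    rw [Real.log_pow, abs_of_pos (by push_cast; linarith)]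
    push_cast; linarith

lemma K_exp {s : ℝ} {z : E2} (hz : z ≠ 0) : Real.exp (-(1+s) * Real.log (‖z‖^2)) = K s z := by
  have := norm_pos_iff.2 hz
  unfold K
  rw [← Real.rpow_neg this.le, Real.rpow_def_of_pos this, Real.log_pow]
  congr 1; push_cast; ring

lemma nsq_hd (z e : E2) : HasDerivAt (fun t : ℝ => ‖z + t • e‖^2) (2 * inner ℝ z e) 0 := by
  have h : HasDerivAt (fun t : ℝ => z + t • e) e 0 := by
    simpa using ((hasDerivAt_id (0:ℝ)).smul_const e).const_add z
  have := h.norm_sq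
  simpa using this

lemma kn_dd {a N : ℝ} (hN : 1 ≤ N) (e : E2) {z : E2} (hz : z ≠ 0) :
    dd e (kn a N) z = φ1 a N (Real.log (‖z‖^2)) * (2 * inner ℝ z e / ‖z‖^2) := by
  have h1 := hd ((kn_cd (a := a) hN).differentiable (by norm_num)) z e
  have hn : ‖z + (0:ℝ) • e‖^2 ≠ 0 := by simpa using hz
  have h2 := (nsq_hd z e).log hn
  have h3 := HasDerivAt.comp (h₂ := φ a N) (0:ℝ) (φ_hd a N _) h2
  have hc : Filter.Tendsto (fun t : ℝ => z + t • e) (nhds 0) (nhds z) := by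
    have : Continuous (fun t : ℝ => z + t • e) := by fun_prop
    simpa using this.tendsto 0
  have h4 := h3.congr_of_eventuallyEq (hc.eventually (kn_ev (a := a) (N := N) hz))
  have := h1.unique h4
  simpa using this

lemma kn_ddd {a N : ℝ} (hN : 1 ≤ N) (e : E2) {z : E2} (hz : z ≠ 0) :
    dd e (dd e (kn a N)) z = φ2 a N (Real.log (‖z‖^2)) * (2 * inner ℝ z e / ‖z‖^2)^2 +
      φ1 a N (Real.log (‖z‖^2)) * (2 * ‖e‖^2 / ‖z‖^2 - 4 * (inner ℝ z e)^2 / (‖z‖^2)^2) := by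
  have h1 := hd ((dd_c1 (kn_cd (a := a) hN) e).differentiable (by norm_num)) z e
  have hn : ‖z + (0:ℝ) • e‖^2 ≠ 0 := by simpa using hz
  have h2 := (nsq_hd z e).log hn
  have h3 := HasDerivAt.comp (h₂ := φ1 a N) (0:ℝ) (φ1_hd a N _) h2
  have h5 : HasDerivAt (fun t : ℝ => 2 * inner ℝ (z + t • e) e) (2 * ‖e‖^2) 0 := by
    have h : HasDerivAt (fun t : ℝ => z + t • e) e 0 := by
      simpa using ((hasDerivAt_id (0:ℝ)).smul_const e).const_add z
    have := (h.inner ℝ (hasDerivAt_const (0:ℝ) e)).const_mul 2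
    simpa using this
  have h6 := h3.mul (h5.div (nsq_hd z e) hn)
  have hc : Filter.Tendsto (fun t : ℝ => z + t • e) (nhds 0) (nhds z) := by
    have : Continuous (fun t : ℝ => z + t • e) := by fun_prop
    simpa using this.tendsto 0
  have he : ∀ᶠ t : ℝ in nhds 0, z + t • e ≠ 0 := hc.eventually (isOpen_ne.mem_nhds hz)
  have h4 := h6.congr_of_eventuallyEq (he.mono fun t ht => kn_dd (a := a) hN e ht)
  have := h1.unique h4
  rw [this]
  have hz' : ‖z‖ ≠ 0 := by simpa using hz
  simp only [Function.comp, zero_smul, add_zero, Pi.div_apply]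
  field_simp
  ring

lemma kernels {s : ℝ} (h0 : 0 < s) (e : E2) (he : ‖e‖ = 1) :
    ∃ C, 0 ≤ C ∧ ∃ k : ℕ → E2 → ℝ, (∀ n, ContDiff ℝ 2 (k n)) ∧ (∀ n, HasCompactSupport (k n)) ∧
      (∀ n z, |k n z| ≤ K s z) ∧ (∀ n z, |dd e (k n) z| * ‖z‖ ≤ C * K s z) ∧
      (∀ n z, |dd e (dd e (k n)) z| * ‖z‖^2 ≤ C * K s z) ∧
      (∀ z, z ≠ 0 → Filter.Tendsto (fun n => k n z) Filter.atTop (nhds (K s z))) := by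
  obtain ⟨X, hX, hX1, hX2⟩ := χ_bd
  have a0 : 0 ≤ 1 + s := by linarith
  have hN : ∀ n : ℕ, (1:ℝ) ≤ (n:ℝ) + 1 := fun n => by have := Nat.cast_nonneg (α := ℝ) n; linarith
  set a := 1 + s with ha
  refine ⟨4 * (a ^ 2 + 2 * a * X + X) + 6 * (a + X), by positivity, fun n => kn a (n+1),
    fun n => kn_cd (hN n), fun n => kn_cs (hN n), ?_, ?_, ?_, ?_⟩
  · intro n z
    by_cases hz : z = 0
    · simp [kn, hz, K_nonneg]
    · simp only [kn, hz, if_false]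
      rw [← K_exp hz]; exact (φ_bd hX hX1 hX2 a0 (hN n) _).1
  · intro n z
    by_cases hz : z = 0
    · have := K_nonneg s z
      rw [show ‖z‖ = 0 by simp [hz], mul_zero]; positivity
    · rw [kn_dd (hN n) e hz]
      obtain ⟨_, b1, b2⟩ := φ_bd hX hX1 hX2 a0 (hN n) (Real.log (‖z‖^2))
      rw [ha, K_exp hz, ← ha] at b1 b2
      have hz' := norm_pos_iff.2 hz
      have hk := K_nonneg s z
      have hi : |inner ℝ z e| ≤ ‖z‖ := by simpa [he] using abs_real_inner_le_norm z e
      have : |2 * inner ℝ z e / ‖z‖^2| * ‖z‖ ≤ 2 := by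
        rw [abs_div, abs_mul, abs_of_pos (by positivity : (0:ℝ) < ‖z‖^2), abs_two, div_mul_eq_mul_div,
          div_le_iff₀ (by positivity)]
        nlinarith
      rw [abs_mul, mul_assoc]
      calc _ ≤ (K s z * (a + X)) * 2 := by gcongr
        _ ≤ _ := by
          have : 0 ≤ K s z * (4 * (a ^ 2 + 2 * a * X + X) + 4 * (a + X)) := by positivity
          linarith
  · intro n z
    by_cases hz : z = 0
    · have := K_nonneg s z
      rw [show ‖z‖ = 0 by simp [hz]]; simp only [ne_eq, OfNat.ofNat_ne_zero, not_false_eq_true, zero_pow, mul_zero]; positivity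
    · rw [kn_ddd (hN n) e hz]
      obtain ⟨_, b1, b2⟩ := φ_bd hX hX1 hX2 a0 (hN n) (Real.log (‖z‖^2))
      rw [ha, K_exp hz, ← ha] at b1 b2
      have hz' := norm_pos_iff.2 hz
      have hk := K_nonneg s z
      have hi : |inner ℝ z e| ≤ ‖z‖ := by simpa [he] using abs_real_inner_le_norm z e
      have hi2 : (inner ℝ z e)^2 ≤ ‖z‖^2 := sq_le_sq.2 (by rwa [abs_of_pos hz'])
      have t1 : (2 * inner ℝ z e / ‖z‖^2)^2 * ‖z‖^2 ≤ 4 := by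
        have : (2 * inner ℝ z e / ‖z‖^2)^2 * ‖z‖^2 = 4 * (inner ℝ z e)^2 / ‖z‖^2 := by
          field_simp; ring
        rw [this, div_le_iff₀ (by positivity)]; linarith
      have t2 : |2 * ‖e‖^2 / ‖z‖^2 - 4 * (inner ℝ z e)^2 / (‖z‖^2)^2| * ‖z‖^2 ≤ 6 := by
        have : (2 * ‖e‖^2 / ‖z‖^2 - 4 * (inner ℝ z e)^2 / (‖z‖^2)^2) * ‖z‖^2 =
            2 - 4 * ((inner ℝ z e)^2 / ‖z‖^2) := by
          rw [he]; field_simp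
        rw [← abs_of_pos (by positivity : (0:ℝ) < ‖z‖^2), ← abs_mul, abs_of_pos (by positivity : (0:ℝ) < ‖z‖^2), this]
        have q1 : 0 ≤ (inner ℝ z e)^2 / ‖z‖^2 := by positivity
        have q2 : (inner ℝ z e)^2 / ‖z‖^2 ≤ 1 := by rw [div_le_one (by positivity)]; exact hi2
        rw [abs_le]; constructor <;> linarith
      refine (mul_le_mul_of_nonneg_right (abs_add_le _ _) (sq_nonneg ‖z‖)).trans ?_
      have hsq : 0 ≤ (2 * inner ℝ z e / ‖z‖^2)^2 := sq_nonneg _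
      rw [add_mul, abs_mul, abs_mul, abs_of_nonneg hsq, mul_assoc, mul_assoc]
      calc _ ≤ (K s z * (a ^ 2 + 2 * a * X + X)) * 4 + (K s z * (a + X)) * 6 := by gcongr
        _ = _ := by ring
  · intro z hz
    refine tendsto_const_nhds.congr' ?_
    filter_upwards [Filter.eventually_ge_atTop (⌈|Real.log (‖z‖^2)|⌉₊)] with n hn
    have h : |Real.log (‖z‖^2)| ≤ n + 1 := by
      have := (Nat.le_ceil _).trans (Nat.cast_le (α := ℝ).2 hn); linarith
    have : (χ : ℝ → ℝ) (Real.log (‖z‖^2) / ((n:ℝ)+1)) = 1 := by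
      refine χ.one_of_mem_closedBall ?_
      rw [mem_closedBall, dist_zero_right, Real.norm_eq_abs, abs_div, abs_of_pos (by positivity : (0:ℝ) < (n:ℝ)+1)]
      show _ ≤ (1:ℝ)
      rw [div_le_one (by positivity)]; exact h
    simp only [kn, hz, if_false, φ, this, mul_one]
    rw [ha, K_exp hz]

end FL


namespace FL

noncomputable def DD (e : E2) (ζ k : E2 → ℝ) (p : E2 × E2) : ℝ :=
  -2 * dd e ζ p.1 * dd e ζ (p.1+p.2) * k p.2
  + 2 * (ζ p.1 - ζ (p.1+p.2)) * dd e ζ (p.1+p.2) * dd e k p.2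
  + 2 * (ζ p.1 - ζ (p.1+p.2)) * dd e ζ p.1 * dd e k p.2
  - (ζ p.1 - ζ (p.1+p.2))^2 * dd e (dd e k) p.2

lemma line_eq {G : E2 × E2 → ℝ} (hG : ContDiff ℝ 1 G) (p w : E2 × E2) {d : ℝ}
    (h : HasDerivAt (fun t : ℝ => G (p + t • w)) d 0) : fderiv ℝ G p w = d := by
  have := ((hG.differentiable (by norm_num)) p).hasFDerivAt.hasLineDerivAt w
  exact HasDerivAt.unique this h

lemma ident {u ζ k : E2 → ℝ} (hu : ContDiff ℝ 2 u) (hζ : ContDiff ℝ 2 ζ) (hζc : HasCompactSupport ζ)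
    (hk : ContDiff ℝ 2 k) (hkc : HasCompactSupport k) (e : E2) :
    Integrable (fun p : E2 × E2 => dd e u p.1 * dd e u (p.1+p.2) * (ζ p.1 - ζ (p.1+p.2))^2 * k p.2) ∧
    Integrable (fun p : E2 × E2 => -(1/2) * (u p.1 - u (p.1+p.2))^2 * DD e ζ k p) ∧
    ∫ p : E2 × E2, dd e u p.1 * dd e u (p.1+p.2) * (ζ p.1 - ζ (p.1+p.2))^2 * k p.2 =
      ∫ p : E2 × E2, -(1/2) * (u p.1 - u (p.1+p.2))^2 * DD e ζ k p := by
  obtain ⟨R1, hR1⟩ := cs_ball hζc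
  obtain ⟨R2, hR2⟩ := cs_ball hkc
  obtain ⟨R3, hR3⟩ := cs_ball (dd_compact hkc e)
  obtain ⟨R4, hR4⟩ := cs_ball (dd_compact (dd_compact hkc e) e)
  obtain ⟨R5, hR5⟩ := cs_ball (dd_compact hζc e)
  set Rz := max R2 (max R3 R4) with hRz
  set Rx := max R1 R5 with hRx
  have supp : ∀ G : E2 × E2 → ℝ, (∀ x z, (k z = 0 → dd e k z = 0 → dd e (dd e k) z = 0 → G (x, z) = 0) ∧
      (ζ x = 0 → ζ (x+z) = 0 → dd e ζ x = 0 → dd e ζ (x+z) = 0 → G (x,z) = 0)) → HasCompactSupport G := by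
    intro G hG
    refine HasCompactSupport.intro ((isCompact_closedBall (0:E2) (Rx + Rz)).prod (isCompact_closedBall (0:E2) Rz)) ?_
    rintro ⟨x, z⟩ hxz
    by_cases hz : ‖z‖ ≤ Rz
    · have hx : Rx + Rz < ‖x‖ := by
        by_contra hx
        exact hxz ⟨by simpa using not_lt.1 hx, by simpa using hz⟩
      have hxz' : Rx < ‖x + z‖ := by
        have := norm_sub_le (x+z) z
        rw [add_sub_cancel_right] at this; linarith
      have hx2 : Rx < ‖x‖ := by linarith [norm_nonneg z]
      have l1 : R1 ≤ Rx := le_max_left _ _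
      have l5 : R5 ≤ Rx := le_max_right _ _
      exact (hG x z).2 (hR1 _ (by linarith)) (hR1 _ (by linarith)) (hR5 _ (by linarith)) (hR5 _ (by linarith))
    · have l2 : R2 ≤ Rz := le_max_left _ _
      have l3 : R3 ≤ Rz := (le_max_left _ _).trans (le_max_right _ _)
      have l4 : R4 ≤ Rz := (le_max_right _ _).trans (le_max_right _ _)
      exact (hG x z).1 (hR2 _ (by linarith)) (hR3 _ (by linarith)) (hR4 _ (by linarith))
  have v1 := dd_c1 hu e
  have q1 := dd_c1 hζ e
  have ke1 := dd_c1 hk e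
  have u1 : ContDiff ℝ 1 u := hu.of_le (by norm_num)
  have ζ1 : ContDiff ℝ 1 ζ := hζ.of_le (by norm_num)
  have k1 : ContDiff ℝ 1 k := hk.of_le (by norm_num)
  have hkee : Continuous (dd e (dd e k)) := dd_c0 ke1 e
  have pl : ContDiff ℝ 1 (fun p : E2 × E2 => p.1 + p.2) := contDiff_fst.add contDiff_snd
  have c1 := v1.continuous
  have c2 := q1.continuous
  have c3 := ke1.continuous
  have c4 := u1.continuous
  have c5 := ζ1.continuous
  have c6 := k1.continuous
  set G1 : E2 × E2 → ℝ := fun p => -((u p.1 - u (p.1+p.2)) * dd e u p.1 * ((ζ p.1 - ζ (p.1+p.2))^2 * k p.2)) with hG1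
  set G2 : E2 × E2 → ℝ := fun p => 1/2 * (u p.1 - u (p.1+p.2))^2 *
    (-2 * (ζ p.1 - ζ (p.1+p.2)) * dd e ζ (p.1+p.2) * k p.2 + (ζ p.1 - ζ (p.1+p.2))^2 * dd e k p.2) with hG2
  have G1c : ContDiff ℝ 1 G1 :=
    ((((u1.comp contDiff_fst).sub (u1.comp pl)).mul (v1.comp contDiff_fst)).mul
      ((((ζ1.comp contDiff_fst).sub (ζ1.comp pl)).pow 2).mul (k1.comp contDiff_snd))).neg
  have G2c : ContDiff ℝ 1 G2 :=
    (contDiff_const.mul (((u1.comp contDiff_fst).sub (u1.comp pl)).pow 2)).mul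
      ((((contDiff_const.mul ((ζ1.comp contDiff_fst).sub (ζ1.comp pl))).mul (q1.comp pl)).mul (k1.comp contDiff_snd)).add
      ((((ζ1.comp contDiff_fst).sub (ζ1.comp pl)).pow 2).mul (ke1.comp contDiff_snd)))
  have G1s : HasCompactSupport G1 := supp _ fun x z =>
    ⟨fun h _ _ => by simp [hG1, h], fun h h' _ _ => by simp [hG1, h, h']⟩
  have G2s : HasCompactSupport G2 := supp _ fun x z =>
    ⟨fun h h' _ => by simp [hG2, h, h'], fun h h' _ _ => by simp [hG2, h, h']⟩
  haveI : (volume : Measure (E2 × E2)).IsAddHaarMeasure := by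
    rw [Measure.volume_eq_prod]; infer_instance
  have Z1 := int_fderiv_zero (volume : Measure (E2 × E2)) G1c G1s (0, e)
  have Z2 := int_fderiv_zero (volume : Measure (E2 × E2)) G2c G2s (e, -e)
  have J1 : Integrable (fun p : E2 × E2 => dd e u p.1 * dd e u (p.1+p.2) * (ζ p.1 - ζ (p.1+p.2))^2 * k p.2) :=
    Continuous.integrable_of_hasCompactSupport (by fun_prop) (supp _ fun x z =>
      ⟨fun h _ _ => by simp [h], fun h h' _ _ => by simp [h, h']⟩)
  have J2 : Integrable (fun p : E2 × E2 => -(1/2) * (u p.1 - u (p.1+p.2))^2 * DD e ζ k p) :=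
    Continuous.integrable_of_hasCompactSupport (by unfold DD; fun_prop) (supp _ fun x z =>
      ⟨fun h h' h'' => by simp [DD, h, h', h''], fun h h' h'' h''' => by simp [DD, h, h', h'', h''']⟩)
  have I1 : Integrable (fun p => fderiv ℝ G1 p (0, e)) :=
    Continuous.integrable_of_hasCompactSupport
      ((G1c.continuous_fderiv (by norm_num)).clm_apply continuous_const) (G1s.fderiv_apply (𝕜 := ℝ) _)
  have I2 : Integrable (fun p => fderiv ℝ G2 p (e, -e)) :=
    Continuous.integrable_of_hasCompactSupport
      ((G2c.continuous_fderiv (by norm_num)).clm_apply continuous_const) (G2s.fderiv_apply (𝕜 := ℝ) _)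
  refine ⟨J1, J2, ?_⟩
  rw [← sub_eq_zero, ← integral_sub J1 J2]
  rw [← add_zero (0:ℝ)]
  nth_rw 1 [← Z1]
  rw [← Z2, ← integral_add I1 I2]
  refine integral_congr_ae (ae_of_all _ ?_)
  rintro ⟨x, z⟩
  have du := u1.differentiable (by norm_num)
  have dζ := ζ1.differentiable (by norm_num)
  have dk := k1.differentiable (by norm_num)
  have dke := ke1.differentiable (by norm_num)
  have F1 : fderiv ℝ G1 (x,z) (0,e) = -((0 - dd e u (x+z)) * dd e u x * ((ζ x - ζ (x+z))^2 * k z) +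
      (u x - u (x+z)) * dd e u x * (2 * (ζ x - ζ (x+z)) * (0 - dd e ζ (x+z)) * k z + (ζ x - ζ (x+z))^2 * dd e k z)) := by
    refine line_eq G1c _ _ ?_
    have a1 := hd du (x+z) e
    have a2 := hd dζ (x+z) e
    have a3 := hd dk z e
    have b1 := (hasDerivAt_const (0:ℝ) (u x)).sub a1
    have b2 := (hasDerivAt_const (0:ℝ) (ζ x)).sub a2
    have b3 := (((b1.mul_const (dd e u x)).mul ((b2.pow 2).mul a3))).neg
    have e1 : (fun t : ℝ => G1 ((x,z) + t • ((0:E2), e))) = fun t => -((u x - u (x + z + t • e)) * dd e u x *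
        ((ζ x - ζ (x+z + t • e))^2 * k (z + t • e))) := by
      funext t; simp [hG1, add_assoc]
    rw [e1]
    refine b3.congr_deriv ?_
    simp [Pi.sub_apply, Pi.mul_apply, Pi.pow_apply]
  have F2 : fderiv ℝ G2 (x,z) (e,-e) = (u x - u (x+z)) * dd e u x *
      (-2 * (ζ x - ζ (x+z)) * dd e ζ (x+z) * k z + (ζ x - ζ (x+z))^2 * dd e k z) +
      1/2 * (u x - u (x+z))^2 * DD e ζ k (x,z) := by
    refine line_eq G2c _ _ ?_
    have neg : ∀ g : E2 → ℝ, dd (-e) g z = - dd e g z := fun g => by simp [dd]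
    have a1 := hd du x e
    have a2 := hd dζ x e
    have a3 := hd dk z (-e)
    have a4 := hd dke z (-e)
    rw [neg] at a3 a4
    have b1 := a1.sub_const (u (x+z))
    have b2 := a2.sub_const (ζ (x+z))
    have b3 := ((b1.pow 2).const_mul (1/2)).mul
      ((((b2.const_mul (-2)).mul_const (dd e ζ (x+z))).mul a3).add ((b2.pow 2).mul a4))
    have e1 : (fun t : ℝ => G2 ((x,z) + t • (e, -e))) = fun t => 1/2 * (u (x + t • e) - u (x + z))^2 *
      (-2 * (ζ (x + t • e) - ζ (x+z)) * dd e ζ (x+z) * k (z + t • (-e)) + (ζ (x + t • e) - ζ (x+z))^2 * dd e k (z + t • (-e))) := by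
      funext t
      have : x + t • e + (z + -(t • e)) = x + z := by abel
      simp [hG2, this]
    rw [e1]
    refine b3.congr_deriv ?_
    simp [Pi.sub_apply, Pi.mul_apply, Pi.pow_apply, DD]
    ring
  simp only [F1, F2]
  ring

noncomputable def NN (e : E2) (ζ : E2 → ℝ) (p : E2 × E2) : ℝ :=
  |dd e ζ p.1| + |dd e ζ (p.1+p.2)| + |ζ p.1 - ζ (p.1+p.2)| / ‖p.2‖

lemma DD_bd {s C : ℝ} (hC : 0 ≤ C) {e : E2} {ζ k : E2 → ℝ} {x z : E2} (hz : z ≠ 0)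
    (b0 : |k z| ≤ K s z) (b1 : |dd e k z| * ‖z‖ ≤ C * K s z) (b2 : |dd e (dd e k) z| * ‖z‖^2 ≤ C * K s z) :
    |DD e ζ k (x,z)| ≤ (1 + C) * (NN e ζ (x,z)^2 * K s z) := by
  have hz' := norm_pos_iff.2 hz
  have hk := K_nonneg s z
  unfold DD NN
  simp only
  set p := dd e ζ x
  set q := dd e ζ (x+z)
  set δ := ζ x - ζ (x+z)
  set d := |δ| / ‖z‖ with hd
  have hd0 : 0 ≤ d := by positivity
  have hδ : |δ| = d * ‖z‖ := by rw [hd]; field_simp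
  have t1 : |-2 * p * q * k z| ≤ 2 * |p| * |q| * K s z := by
    rw [abs_mul, abs_mul, abs_mul, abs_neg, abs_two]; gcongr
  have t2 : |2 * δ * q * dd e k z| ≤ 2 * d * |q| * (C * K s z) := by
    rw [abs_mul, abs_mul, abs_mul, abs_two, hδ]
    calc _ = 2 * d * |q| * (|dd e k z| * ‖z‖) := by ring
      _ ≤ _ := by gcongr
  have t3 : |2 * δ * p * dd e k z| ≤ 2 * d * |p| * (C * K s z) := by
    rw [abs_mul, abs_mul, abs_mul, abs_two, hδ]
    calc _ = 2 * d * |p| * (|dd e k z| * ‖z‖) := by ring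
      _ ≤ _ := by gcongr
  have t4 : |δ^2 * dd e (dd e k) z| ≤ d^2 * (C * K s z) := by
    rw [abs_mul, abs_pow, hδ]
    calc _ = d^2 * (|dd e (dd e k) z| * ‖z‖^2) := by ring
      _ ≤ _ := by gcongr
  refine (abs_sub _ _).trans ((add_le_add ((abs_add_le _ _).trans (add_le_add ((abs_add_le _ _).trans
    (add_le_add t1 t2)) t3)) t4).trans ?_)
  have r1 : 0 ≤ |p| * |q| * (C * K s z) := by positivity
  have r2 : 0 ≤ d * |p| * K s z := by positivity
  have r3 : 0 ≤ d * |q| * K s z := by positivity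
  have r4 : 0 ≤ (|p|^2 + |q|^2) * ((1+C) * K s z) := by positivity
  have r5 : 0 ≤ d^2 * K s z := by positivity
  nlinarith

lemma gK_bd {s : ℝ} (h0 : 0 < s) (e : E2) (he : ‖e‖ = 1) {u : E2 → ℝ} (hu : ContDiff ℝ 2 u) :
    ∃ C, 0 ≤ C ∧ ∀ ζ : E2 → ℝ, ContDiff ℝ 2 ζ → HasCompactSupport ζ →
      Integrable (fun z => (∫ x, dd e u x * dd e u (x+z) * (ζ x - ζ (x+z))^2) * K s z) →
      ∀ W : E2 × E2 → ℝ, Integrable W →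
      (∀ x z, z ≠ 0 → (u x - u (x+z))^2 * (NN e ζ (x,z)^2 * K s z) ≤ W (x,z)) → (∀ p, 0 ≤ W p) →
      ∫ z, (∫ x, dd e u x * dd e u (x+z) * (ζ x - ζ (x+z))^2) * K s z ≤ C * ∫ p, W p := by
  obtain ⟨C, hC, k, k1, k2, k3, k4, k5, k6⟩ := kernels h0 e he
  refine ⟨(1+C)/2, by positivity, fun ζ hζ hζc hI W hW hWb hW0 => ?_⟩
  set g : E2 → ℝ := fun z => ∫ x, dd e u x * dd e u (x+z) * (ζ x - ζ (x+z))^2 with hg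
  have key : ∀ n, Integrable (fun z => g z * k n z) ∧ ∫ z, g z * k n z ≤ (1+C)/2 * ∫ p, W p := by
    intro n
    obtain ⟨J1, J2, J3⟩ := ident hu hζ hζc (k1 n) (k2 n) e
    have J1' := J1
    rw [Measure.volume_eq_prod] at J1'
    have f1 : ∀ z, ∫ x, dd e u x * dd e u (x+z) * (ζ x - ζ (x+z))^2 * k n z = g z * k n z :=
      fun z => by rw [integral_mul_const]
    constructor
    · have := J1'.integral_prod_right
      simpa only [f1] using this
    · have f2 : ∫ z, g z * k n z =
          ∫ p : E2 × E2, dd e u p.1 * dd e u (p.1+p.2) * (ζ p.1 - ζ (p.1+p.2))^2 * k n p.2 := by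
        rw [Measure.volume_eq_prod, integral_prod_symm _ J1']
        simp only [f1]
      rw [f2, J3, ← integral_const_mul]
      refine integral_mono J2 (hW.const_mul _) ?_
      rintro ⟨x, z⟩
      simp only
      by_cases hz : z = 0
      · simp only [hz, add_zero, sub_self]
        have := hW0 (x, 0)
        simp only [ne_eq, OfNat.ofNat_ne_zero, not_false_eq_true, zero_pow, mul_zero, zero_mul]; positivity
      · have b := DD_bd (ζ := ζ) (x := x) hC hz (k3 n z) (k4 n z) (k5 n z)
        have w := hWb x z hz
        have b' := (abs_le.1 b).1
        have sq : 0 ≤ (u x - u (x+z))^2 := sq_nonneg _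
        calc _ = 1/2 * (u x - u (x+z))^2 * (- DD e ζ (k n) (x,z)) := by ring
          _ ≤ 1/2 * (u x - u (x+z))^2 * ((1 + C) * (NN e ζ (x,z)^2 * K s z)) := by
            gcongr; linarith
          _ = (1+C)/2 * ((u x - u (x+z))^2 * (NN e ζ (x,z)^2 * K s z)) := by ring
          _ ≤ _ := by gcongr
  have lim : Filter.Tendsto (fun n => ∫ z, g z * k n z) Filter.atTop (nhds (∫ z, g z * K s z)) := by
    refine tendsto_integral_of_dominated_convergence (fun z => ‖g z * K s z‖)
      (fun n => (key n).1.aestronglyMeasurable) hI.norm (fun n => ae_of_all _ fun z => ?_) ?_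
    · rw [norm_mul, norm_mul]
      refine mul_le_mul_of_nonneg_left ?_ (norm_nonneg _)
      rw [Real.norm_eq_abs, Real.norm_eq_abs, abs_of_nonneg (K_nonneg s z)]
      exact k3 n z
    · have : ∀ᵐ z : E2, z ≠ 0 := by simp [ae_iff]
      filter_upwards [this] with z hz
      exact (k6 z hz).const_mul _
  exact le_of_tendsto' lim fun n => (key n).2

end FL


namespace FL

lemma en2 {s : ℝ} (h0 : 0 < s) (h1 : s < 1) {u : E2 → ℝ}
    (hu : ContDiff ℝ 2 u) (hub : ∀ x, |u x| ≤ 1) (R : ℝ) :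
    Integrable (fun p : E2 × E2 => ind R (p.1+p.2) * (u p.1 - u (p.1+p.2))^2 * K s p.2) ∧
    ∫ p : E2 × E2, ind R (p.1+p.2) * (u p.1 - u (p.1+p.2))^2 * K s p.2 =
      ∫ p : E2 × E2, ind R p.1 * (u p.1 - u (p.1+p.2))^2 * K s p.2 := by
  have h := en_int h0 h1 hu hub R
  have hf : ∀ p : E2 × E2, (fun p : E2 × E2 => ind R p.1 * (u p.1 - u (p.1+p.2))^2 * K s p.2) (T p) =
      ind R (p.1+p.2) * (u p.1 - u (p.1+p.2))^2 * K s p.2 := fun p => by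
    simp only [T, K_neg, add_neg_cancel_right]; ring
  constructor
  · exact (T_mp.integrable_comp_of_integrable h).congr (ae_of_all _ hf)
  · rw [← T_mp.integral_comp T_emb (fun p : E2 × E2 => ind R p.1 * (u p.1 - u (p.1+p.2))^2 * K s p.2)]
    exact integral_congr_ae (ae_of_all _ fun p => (hf p).symm)

lemma geo_sum (n : ℕ) : ∀ b : ℕ → ℝ, (∀ i, 0 ≤ b i) → (∀ i, b i ≤ 1) →
    0 ≤ ∑ i ∈ Finset.range n, b i * (1/2)^i ∧ ∑ i ∈ Finset.range n, b i * (1/2)^i ≤ 2 ∧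
    (∑ i ∈ Finset.range n, b i * (1/2)^i)^2 ≤ 4 * ∑ i ∈ Finset.range n, b i * (1/4)^i := by
  induction n with
  | zero => intro b _ _; simp
  | succ n ih =>
    intro b hb0 hb1
    obtain ⟨i1, i2, i3⟩ := ih (fun i => b (i+1)) (fun i => hb0 _) (fun i => hb1 _)
    have e1 : ∑ i ∈ Finset.range (n+1), b i * (1/2)^i = b 0 + 1/2 * ∑ i ∈ Finset.range n, b (i+1) * (1/2)^i := by
      rw [Finset.sum_range_succ', Finset.mul_sum, add_comm]
      congr 1
      · simp
      · exact Finset.sum_congr rfl fun i _ => by ring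
    have e2 : ∑ i ∈ Finset.range (n+1), b i * (1/4)^i = b 0 + 1/4 * ∑ i ∈ Finset.range n, b (i+1) * (1/4)^i := by
      rw [Finset.sum_range_succ', Finset.mul_sum, add_comm]
      congr 1
      · simp
      · exact Finset.sum_congr rfl fun i _ => by ring
    rw [e1, e2]
    have := hb0 0
    have := hb1 0
    refine ⟨by positivity, by linarith, ?_⟩
    nlinarith

lemma ψ_lip : ∃ Λ, 0 ≤ Λ ∧ ∀ ρ, 0 < ρ → (∀ x y, |cut ρ x - cut ρ y| ≤ Λ / ρ * ‖x - y‖) ∧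
    (∀ e x : E2, ‖e‖ = 1 → |dd e (cut ρ) x| ≤ Λ / ρ) := by
  obtain ⟨Λ, hΛ⟩ := (ψ_cd.of_le (by norm_num) : ContDiff ℝ 1 (ψ : E2 → ℝ)).lipschitzWith_of_hasCompactSupport ψ_cs (by norm_num)
  refine ⟨Λ, Λ.2, fun ρ hρ => ?_⟩
  have h : ∀ x y, |cut ρ x - cut ρ y| ≤ Λ / ρ * ‖x - y‖ := fun x y => by
    have := hΛ.dist_le_mul (ρ⁻¹ • x) (ρ⁻¹ • y)
    rw [Real.dist_eq, dist_eq_norm, ← smul_sub, norm_smul, norm_inv, Real.norm_eq_abs, abs_of_pos hρ] at this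
    refine this.trans (le_of_eq ?_)
    ring
  refine ⟨h, fun e x he => ?_⟩
  have hl : LipschitzWith (Λ / ⟨ρ, hρ.le⟩) (cut ρ) := LipschitzWith.of_dist_le_mul fun x y => by
    rw [Real.dist_eq, dist_eq_norm]; exact h x y
  have := norm_fderiv_le_of_lipschitz ℝ hl (x₀ := x)
  unfold dd
  have h2 := (fderiv ℝ (cut ρ) x).le_opNorm e
  rw [he, mul_one] at h2
  exact h2.trans this

lemma cut_dd_zero {ρ : ℝ} (hρ : 0 < ρ) (e : E2) {x : E2} (h : 2 * ρ < ‖x‖) : dd e (cut ρ) x = 0 := by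
  have : cut ρ =ᶠ[nhds x] fun _ => 0 := by
    filter_upwards [(isOpen_lt continuous_const continuous_norm).mem_nhds h] with y hy
    exact cut_zero hρ hy
  unfold dd
  rw [this.fderiv_eq]; simp

noncomputable def bb (R : ℝ) (x z : E2) : ℝ := max (ind R x) (ind R (x+z))

lemma NN_cut {Λ : ℝ} (hΛ0 : 0 ≤ Λ) {ρ : ℝ} (hρ : 0 < ρ) (h1 : ∀ x y, |cut ρ x - cut ρ y| ≤ Λ / ρ * ‖x - y‖)
    {e : E2} (h2 : ∀ x, |dd e (cut ρ) x| ≤ Λ / ρ) (x z : E2) :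
    NN e (cut ρ) (x,z) ≤ 3 * Λ / ρ * bb (2*ρ) x z := by
  have b0 : 0 ≤ bb (2*ρ) x z := (ind_nonneg _ _).trans (le_max_left _ _)
  by_cases hb : ‖x‖ ≤ 2*ρ ∨ ‖x+z‖ ≤ 2*ρ
  · have b1 : 1 ≤ bb (2*ρ) x z := by
      rcases hb with h | h
      · rw [← ind_of h]; exact le_max_left _ _
      · rw [← ind_of h]; exact le_max_right _ _
    have hd : |cut ρ x - cut ρ (x+z)| / ‖z‖ ≤ Λ / ρ := by
      refine div_le_of_le_mul₀ (norm_nonneg _) (by positivity) ?_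
      have := h1 x (x+z)
      simpa using this
    have : NN e (cut ρ) (x,z) ≤ 3 * Λ / ρ := by
      unfold NN
      have a := h2 x
      have b := h2 (x+z)
      have : 3 * Λ / ρ = Λ / ρ + Λ / ρ + Λ / ρ := by ring
      rw [this]; simp only; linarith
    exact this.trans (le_mul_of_one_le_right (by positivity) b1)
  · push Not at hb
    have : NN e (cut ρ) (x,z) = 0 := by
      simp [NN, cut_zero hρ hb.1, cut_zero hρ hb.2, cut_dd_zero hρ e hb.1, cut_dd_zero hρ e hb.2]
    rw [this]; positivity

/-- averaged cutoff -/
noncomputable def av (R : ℝ) (N : ℕ) (x : E2) : ℝ := ((N:ℝ)+1)⁻¹ * ∑ i ∈ Finset.range (N+1), cut (R * 2^i) x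

lemma av_cd (R : ℝ) (N : ℕ) : ContDiff ℝ 2 (av R N) :=
  contDiff_const.mul (ContDiff.sum fun i _ => cut_cd _)

lemma av_cs {R : ℝ} (hR : 1 ≤ R) (N : ℕ) : HasCompactSupport (av R N) := by
  refine HasCompactSupport.intro (isCompact_closedBall (0:E2) (2 * (R * 2^N))) fun x hx => ?_
  rw [mem_closedBall, dist_zero_right, not_le] at hx
  unfold av
  rw [Finset.sum_eq_zero, mul_zero]
  intro i hi
  refine cut_zero (by positivity) (lt_of_le_of_lt ?_ hx)
  have : i ≤ N := Nat.lt_succ_iff.1 (Finset.mem_range.1 hi)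
  gcongr
  norm_num

lemma av_one {R : ℝ} (hR : 1 ≤ R) (N : ℕ) {x : E2} (hx : ‖x‖ ≤ R) : av R N x = 1 := by
  unfold av
  rw [Finset.sum_congr rfl (g := fun _ => (1:ℝ))]
  · simp only [Finset.sum_const, Finset.card_range, nsmul_eq_mul, mul_one]; push_cast
    exact inv_mul_cancel₀ (by positivity)
  · intro i _
    refine cut_one (by positivity) (hx.trans ?_)
    exact le_mul_of_one_le_right (by linarith) (one_le_pow₀ (by norm_num))

lemma NN_av (e : E2) (R : ℝ) (N : ℕ) (x z : E2) :
    NN e (av R N) (x,z) ≤ ((N:ℝ)+1)⁻¹ * ∑ i ∈ Finset.range (N+1), NN e (cut (R * 2^i)) (x,z) := by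
  have hdd : ∀ y, dd e (av R N) y = ((N:ℝ)+1)⁻¹ * ∑ i ∈ Finset.range (N+1), dd e (cut (R * 2^i)) y := by
    intro y
    have hdf : ∀ i, DifferentiableAt ℝ (cut (R * 2^i)) y := fun i =>
      ((cut_cd (R * 2^i)).differentiable (by norm_num)) y
    have h : HasFDerivAt (av R N) (((N:ℝ)+1)⁻¹ • ∑ i ∈ Finset.range (N+1), fderiv ℝ (cut (R * 2^i)) y) y := by
      unfold av
      exact (HasFDerivAt.fun_sum fun i _ => (hdf i).hasFDerivAt).const_mul _
    unfold dd
    rw [h.fderiv]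
    simp
  have hN : (0:ℝ) ≤ ((N:ℝ)+1)⁻¹ := by positivity
  have ab : ∀ a : ℕ → ℝ, |((N:ℝ)+1)⁻¹ * ∑ i ∈ Finset.range (N+1), a i| ≤
      ((N:ℝ)+1)⁻¹ * ∑ i ∈ Finset.range (N+1), |a i| := fun a => by
    rw [abs_mul, abs_of_nonneg hN]
    exact mul_le_mul_of_nonneg_left (Finset.abs_sum_le_sum_abs _ _) hN
  have hδ : av R N x - av R N (x+z) = ((N:ℝ)+1)⁻¹ * ∑ i ∈ Finset.range (N+1), (cut (R * 2^i) x - cut (R * 2^i) (x+z)) := by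
    unfold av
    rw [Finset.sum_sub_distrib]; ring
  unfold NN
  simp only [hdd, hδ]
  refine (add_le_add (add_le_add (ab _) (ab _)) (div_le_div_of_nonneg_right (ab _) (norm_nonneg _))).trans (le_of_eq ?_)
  simp only [Finset.sum_add_distrib, ← Finset.sum_div]
  ring

lemma sgn {s : ℝ} (h0 : 0 < s) (h1 : s < 1) {c : ℝ} (hc0 : 0 < c) {u q F : E2 → ℝ}
    (hu : ContDiff ℝ 2 u) (hub : ∀ x, |u x| ≤ 1) (hq : Continuous q) (hF : ContDiff ℝ 1 F)
    {MF : ℝ} (hMF : ∀ x, |F x| ≤ MF)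
    (e : E2) (he : ‖e‖ = 1) (hFq : ∀ x, dd e F x = q x * dd e u x)
    (heq : ∀ x, c / 2 * ∫ y, (2 * u x - u (x+y) - u (x-y)) * K s y = F x)
    (hst : ∀ η : E2 → ℝ, ContDiff ℝ (⊤ : ℕ∞) η → HasCompactSupport η →
      ∫ x, q x * (η x)^2 ≤ c / 2 * ∫ x : E2, ∫ y : E2, (η x - η y)^2 / ‖x - y‖ ^ (((2:ℕ):ℝ) + 2*s))
    {x0 y0 : E2} (hx0 : 0 < dd e u x0) (hy0 : dd e u y0 < 0) : False := by
  set v := dd e u with hv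
  have hvc : Continuous v := (dd_c1 hu e).continuous
  obtain ⟨C, hC0, hC⟩ := gK_bd h0 e he hu
  obtain ⟨A, hA0, hA⟩ := cacc h0 h1 hc0 hu hub hF.continuous hMF heq
  obtain ⟨Λ, hΛ0, hΛ⟩ := ψ_lip
  set R := max 1 (max (‖x0‖+1) (‖y0‖+1)) with hR
  have hR1 : 1 ≤ R := le_max_left _ _
  have hRx : ‖x0‖ < R := lt_of_lt_of_le (by linarith) ((le_max_left _ _).trans (le_max_right _ _) : ‖x0‖+1 ≤ R)
  have hRy : ‖y0‖ < R := lt_of_lt_of_le (by linarith) ((le_max_right _ _).trans (le_max_right _ _) : ‖y0‖+1 ≤ R)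
  set S : Set (E2 × E2) := {p | ‖p.1‖ < R ∧ ‖p.1+p.2‖ < R} with hS
  have o1 : IsOpen {p : E2 × E2 | ‖p.1‖ < R} := isOpen_lt (by fun_prop) (by fun_prop)
  have o2 : IsOpen {p : E2 × E2 | ‖p.1+p.2‖ < R} := isOpen_lt (by fun_prop) (by fun_prop)
  have hSo : IsOpen S := o1.inter o2
  set f0 : E2 × E2 → ℝ := S.indicator (fun p => (|v p.1 * v (p.1+p.2)| - v p.1 * v (p.1+p.2)) * K s p.2) with hf0
  have f0n : ∀ p, 0 ≤ f0 p := fun p => indicator_nonneg (fun p _ =>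
    mul_nonneg (sub_nonneg.2 (le_abs_self _)) (K_nonneg _ _)) p
  have f0m : AEStronglyMeasurable f0 := by
    refine AEStronglyMeasurable.indicator (Measurable.aestronglyMeasurable ?_) hSo.measurableSet
    have := K_meas s
    have := hvc.measurable
    exact Measurable.mul (Continuous.measurable (by fun_prop)) (by fun_prop)
  have main : ∀ N : ℕ, Integrable f0 ∧ 2 * ∫ p, f0 p ≤ C * (288 * Λ^2 * A) * ((N:ℝ)+1)⁻¹ := by
    intro N
    obtain ⟨D1, D2, D3⟩ := stageD h0 h1 hc0 hu hub hq hF e hFq heq hst (av_cd R N) (av_cs hR1 N)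
    have le1 : ∀ p, f0 p ≤ (|av R N p.1 * v p.1 * (av R N (p.1+p.2) * v (p.1+p.2))|
        - av R N p.1 * v p.1 * (av R N (p.1+p.2) * v (p.1+p.2))) * K s p.2 := fun p => by
      by_cases hp : p ∈ S
      · rw [hf0, indicator_of_mem hp, av_one hR1 N hp.1.le, av_one hR1 N hp.2.le, one_mul, one_mul]
      · rw [hf0, indicator_of_notMem hp]
        exact mul_nonneg (sub_nonneg.2 (le_abs_self _)) (K_nonneg _ _)
    have f0i : Integrable f0 := D1.mono' f0m (ae_of_all _ fun p => by
      rw [Real.norm_eq_abs, abs_of_nonneg (f0n p)]; exact le1 p)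
    refine ⟨f0i, ?_⟩
    have m1 : ∫ p, f0 p ≤ _ := integral_mono f0i D1 le1
    set en : ℝ → E2 × E2 → ℝ := fun r p => ind r p.1 * (u p.1 - u (p.1+p.2))^2 * K s p.2 +
      ind r (p.1+p.2) * (u p.1 - u (p.1+p.2))^2 * K s p.2 with hen
    have enI : ∀ r, Integrable (en r) := fun r => (en_int h0 h1 hu hub r).add (en2 h0 h1 hu hub r).1
    have enb : ∀ r, 1 ≤ r → ∫ p, en r p ≤ 2 * (A * r^2) := fun r hr => by
      rw [hen]
      simp only
      rw [integral_add (en_int h0 h1 hu hub r) (en2 h0 h1 hu hub r).1, (en2 h0 h1 hu hub r).2]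
      have := hA r hr
      linarith
    set B := 36 * Λ^2 / (((N:ℝ)+1)^2 * R^2) with hB
    set W : E2 × E2 → ℝ := fun p => B * ∑ i ∈ Finset.range (N+1), (1/4)^i * en (2 * (R * 2^i)) p with hW
    have WI : Integrable W := (integrable_finsetSum _ fun i _ => (enI _).const_mul _).const_mul _
    have en0 : ∀ r p, 0 ≤ en r p := fun r p => by
      have := ind_nonneg r p.1
      have := ind_nonneg r (p.1+p.2)
      have := K_nonneg s p.2
      simp only [hen]; positivity
    have W0 : ∀ p, 0 ≤ W p := fun p => by
      refine mul_nonneg (by positivity) (Finset.sum_nonneg fun i _ => mul_nonneg (by positivity) (en0 _ _))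
    have Wb : ∀ x z, z ≠ 0 → (u x - u (x+z))^2 * (NN e (av R N) (x,z)^2 * K s z) ≤ W (x,z) := by
      intro x z _
      have k0 := K_nonneg s z
      have bn : ∀ r, 0 ≤ bb r x z := fun r => (ind_nonneg _ _).trans (le_max_left _ _)
      have b1 : ∀ r, bb r x z ≤ 1 := fun r => max_le (ind_le_one _ _) (ind_le_one _ _)
      have n0 : 0 ≤ NN e (av R N) (x,z) := by unfold NN; positivity
      have nb : NN e (av R N) (x,z) ≤ 3 * Λ / (((N:ℝ)+1) * R) *
          ∑ i ∈ Finset.range (N+1), bb (2 * (R * 2^i)) x z * (1/2)^i := by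
        refine (NN_av e R N x z).trans ?_
        calc _ ≤ ((N:ℝ)+1)⁻¹ * ∑ i ∈ Finset.range (N+1), 3 * Λ / (R * 2^i) * bb (2 * (R * 2^i)) x z := by
              gcongr with i hi
              have hp : 0 < R * 2^i := by positivity
              exact NN_cut hΛ0 hp (hΛ _ hp).1 (fun x => (hΛ _ hp).2 e x he) x z
          _ = _ := by
              rw [Finset.mul_sum, Finset.mul_sum]
              refine Finset.sum_congr rfl fun i _ => ?_
              rw [one_div, inv_pow]
              field_simp
      obtain ⟨_, _, g3⟩ := geo_sum (N+1) (fun i => bb (2 * (R * 2^i)) x z) (fun i => bn _) (fun i => b1 _)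
      have nb2 : NN e (av R N) (x,z)^2 ≤ B * ∑ i ∈ Finset.range (N+1), bb (2 * (R * 2^i)) x z * (1/4)^i := by
        calc _ ≤ (3 * Λ / (((N:ℝ)+1) * R) *
          ∑ i ∈ Finset.range (N+1), bb (2 * (R * 2^i)) x z * (1/2)^i)^2 := by gcongr
          _ = (3 * Λ / (((N:ℝ)+1) * R))^2 * (∑ i ∈ Finset.range (N+1), bb (2 * (R * 2^i)) x z * (1/2)^i)^2 := by ring
          _ ≤ (3 * Λ / (((N:ℝ)+1) * R))^2 * (4 * ∑ i ∈ Finset.range (N+1), bb (2 * (R * 2^i)) x z * (1/4)^i) := by gcongr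
          _ = _ := by
            generalize ∑ i ∈ Finset.range (N+1), bb (2 * (R * 2^i)) x z * (1/4)^i = Q
            rw [hB]; field_simp; ring
      calc _ ≤ (u x - u (x+z))^2 * ((B * ∑ i ∈ Finset.range (N+1), bb (2 * (R * 2^i)) x z * (1/4)^i) * K s z) := by gcongr
        _ = B * ∑ i ∈ Finset.range (N+1), (1/4)^i * (bb (2 * (R * 2^i)) x z * (u x - u (x+z))^2 * K s z) := by
          rw [mul_assoc, Finset.sum_mul, mul_left_comm, Finset.mul_sum]
          congr 1
          exact Finset.sum_congr rfl fun i _ => by ring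
        _ ≤ _ := by
          simp only [hW, hen]
          gcongr with i hi
          rw [← add_mul, ← add_mul]
          gcongr
          have a1 := ind_nonneg (2 * (R * 2^i)) x
          have a2 := ind_nonneg (2 * (R * 2^i)) (x+z)
          exact max_le (by linarith) (by linarith)
    have Wi : ∫ p, W p ≤ (288 * Λ^2 * A) * ((N:ℝ)+1)⁻¹ := by
      rw [hW, integral_const_mul, integral_finsetSum _ fun i _ => (enI _).const_mul _]
      simp only [integral_const_mul]
      calc _ ≤ B * ∑ i ∈ Finset.range (N+1), 8 * A * R^2 := by
            refine mul_le_mul_of_nonneg_left (Finset.sum_le_sum fun i _ => ?_) (by positivity)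
            have h2 : (1:ℝ) ≤ 2^i := one_le_pow₀ (by norm_num)
            have := enb (2 * (R * 2^i)) (by nlinarith)
            calc _ ≤ (1/4:ℝ)^i * (2 * (A * (2 * (R * 2^i))^2)) := by gcongr
              _ = 8 * A * R^2 * ((1/4:ℝ)^i * (2^i)^2) := by ring
              _ = _ := by
                rw [← pow_mul, mul_comm i 2, pow_mul, ← mul_pow]; norm_num
        _ = _ := by
          simp only [Finset.sum_const, Finset.card_range, nsmul_eq_mul, hB]; push_cast
          field_simp; ring
    have := hC (av R N) (av_cd R N) (av_cs hR1 N) D2 W WI Wb W0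
    calc 2 * ∫ p, f0 p ≤ _ := mul_le_mul_of_nonneg_left m1 (by norm_num)
      _ ≤ _ := D3
      _ ≤ _ := this
      _ ≤ C * ((288 * Λ^2 * A) * ((N:ℝ)+1)⁻¹) := by gcongr
      _ = _ := by ring
  have f0i := (main 0).1
  have le0 : 2 * ∫ p, f0 p ≤ 0 := by
    have t : Filter.Tendsto (fun N : ℕ => C * (288 * Λ^2 * A) * ((N:ℝ)+1)⁻¹) Filter.atTop (nhds (C * (288 * Λ^2 * A) * 0)) := by
      have := tendsto_one_div_add_atTop_nhds_zero_nat (𝕜 := ℝ)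
      simp only [one_div] at this
      exact this.const_mul _
    rw [mul_zero] at t
    exact ge_of_tendsto' t fun N => (main N).2
  have z0 : ∫ p, f0 p = 0 := le_antisymm (by linarith) (integral_nonneg f0n)
  have ae0 : f0 =ᵐ[volume] 0 := (integral_eq_zero_iff_of_nonneg f0n f0i).1 z0
  set O : Set (E2 × E2) := S ∩ {p | 0 < v p.1 ∧ v (p.1+p.2) < 0} with hO
  have o3 : IsOpen {p : E2 × E2 | 0 < v p.1} := isOpen_lt (by fun_prop) (by fun_prop)
  have o4 : IsOpen {p : E2 × E2 | v (p.1+p.2) < 0} := isOpen_lt (by fun_prop) (by fun_prop)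
  have hOo : IsOpen O := hSo.inter (o3.inter o4)
  have hOn : O.Nonempty := ⟨(x0, y0 - x0), ⟨by simpa using hRx, by simpa using hRy⟩, by simpa using hx0, by simpa using hy0⟩
  have hsub : O ⊆ {p | ¬ f0 p = (0 : E2 × E2 → ℝ) p} := by
    rintro ⟨x, z⟩ ⟨hp, hp1, hp2⟩
    simp only at hp1 hp2
    have hz : z ≠ 0 := by
      rintro rfl
      rw [add_zero] at hp2; linarith
    have hz' := norm_pos_iff.2 hz
    have kp : 0 < K s z := by unfold K; positivity
    have : 0 < f0 (x,z) := by
      rw [hf0, indicator_of_mem hp]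
      have : v x * v (x+z) < 0 := mul_neg_of_pos_of_neg hp1 hp2
      refine mul_pos ?_ kp
      simp only
      rw [abs_of_neg this]; linarith
    exact this.ne'
  have hnull : volume O = 0 := measure_mono_null hsub (ae_iff.1 ae0)
  have hpos : (volume : Measure (E2 × E2)).IsOpenPosMeasure := by
    rw [Measure.volume_eq_prod]; infer_instance
  exact (hOo.measure_pos volume hOn).ne' hnull

end FL

namespace FL

lemma geom {u : E2 → ℝ} (hu : ContDiff ℝ 2 u)
    (h : ∀ e : E2, ‖e‖ = 1 → (∀ x, 0 ≤ dd e u x) ∨ (∀ x, dd e u x ≤ 0)) :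
    ∃ e : E2, ‖e‖ = 1 ∧ ∃ g : ℝ → ℝ, ∀ x : E2, u x = g (@inner ℝ _ _ x e) := by
  have hdu := hu.differentiable (by norm_num)
  have hc : ∀ x, Continuous fun e => dd e u x := fun x => (fderiv ℝ u x).continuous
  have c1 : IsClosed {e : E2 | ∀ x, 0 ≤ dd e u x} := by
    rw [setOf_forall]
    exact isClosed_iInter fun x => isClosed_le continuous_const (hc x)
  have c2 : IsClosed {e : E2 | ∀ x, dd e u x ≤ 0} := by
    rw [setOf_forall]
    exact isClosed_iInter fun x => isClosed_le (hc x) continuous_const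
  have hneg : ∀ e x, dd (-e) u x = - dd e u x := fun e x => by simp [dd]
  have hs : IsPreconnected (sphere (0:E2) 1) := by
    refine isPreconnected_sphere ?_ _ _
    rw [← Module.finrank_eq_rank]; simp
  obtain ⟨b, hb⟩ : ∃ b : E2, ‖b‖ = 1 := ⟨EuclideanSpace.single 0 1, by simp⟩
  have hnb : ‖-b‖ = 1 := by rwa [norm_neg]
  have key : (sphere (0:E2) 1 ∩ ({e : E2 | ∀ x, 0 ≤ dd e u x} ∩ {e : E2 | ∀ x, dd e u x ≤ 0})).Nonempty := by
    refine isPreconnected_closed_iff.1 hs _ _ c1 c2 (fun e he => h e (by simpa using he)) ?_ ?_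
    · rcases h b hb with h1 | h1
      · exact ⟨b, by simpa using hb, h1⟩
      · exact ⟨-b, by simpa using hb, fun x => by rw [hneg]; linarith [h1 x]⟩
    · rcases h b hb with h1 | h1
      · exact ⟨-b, by simpa using hb, fun x => by rw [hneg]; linarith [h1 x]⟩
      · exact ⟨b, by simpa using hb, h1⟩
  obtain ⟨d, hd1, hd2, hd3⟩ := key
  have hd0 : ∀ x, dd d u x = 0 := fun x => le_antisymm (hd3 x) (hd2 x)
  have hdn : d 0 ^ 2 + d 1 ^ 2 = 1 := by
    have : ‖d‖ = 1 := by simpa using hd1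
    have h2 := EuclideanSpace.norm_sq_eq d
    rw [this, Fin.sum_univ_two] at h2
    simpa using h2.symm
  have tr : ∀ x (t : ℝ), u (x + t • d) = u x := by
    intro x t
    have hder : ∀ τ : ℝ, HasDerivAt (fun t : ℝ => u (x + t • d)) 0 τ := by
      intro τ
      have hl : HasDerivAt (fun t : ℝ => x + t • d) d τ := by
        simpa using ((hasDerivAt_id τ).smul_const d).const_add x
      have := (hdu (x + τ • d)).hasFDerivAt.comp_hasDerivAt τ hl
      exact this.congr_deriv (hd0 _)
    have := is_const_of_deriv_eq_zero (f := fun t : ℝ => u (x + t • d))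
      (fun τ => (hder τ).differentiableAt) (fun τ => (hder τ).deriv) t 0
    simpa using this
  refine ⟨!₂[-d 1, d 0], ?_, fun τ => u (τ • !₂[-d 1, d 0]), fun x => ?_⟩
  · have h2 := EuclideanSpace.norm_sq_eq (!₂[-d 1, d 0] : E2)
    rw [Fin.sum_univ_two] at h2
    simp only [Real.norm_eq_abs, sq_abs] at h2
    have h3 : ‖(!₂[-d 1, d 0] : E2)‖^2 = 1 := by
      rw [h2]; simp; linarith
    have := norm_nonneg (!₂[-d 1, d 0] : E2)
    nlinarith
  · have hin : inner ℝ x (!₂[-d 1, d 0] : E2) = -x 0 * d 1 + x 1 * d 0 := by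
      rw [PiLp.inner_apply, Fin.sum_univ_two]
      simp; ring
    have : x = (inner ℝ x (!₂[-d 1, d 0] : E2)) • (!₂[-d 1, d 0] : E2) + (x 0 * d 0 + x 1 * d 1) • d := by
      rw [hin]
      ext i
      fin_cases i
      · simp; linear_combination (-x 0) * hdn
      · simp; linear_combination (-x 1) * hdn
    conv_lhs => rw [this]
    exact tr _ _

lemma fracC_pos {s : ℝ} (h0 : 0 < s) (h1 : s < 1) : 0 < fracC 2 s := by
  unfold fracC
  have g1 : 0 < Real.Gamma (((2:ℕ):ℝ)/2 + s) := Real.Gamma_pos_of_pos (by positivity)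
  have g2 : Real.Gamma (-s) ≠ 0 := by
    refine Real.Gamma_ne_zero fun m hm => ?_
    have hm' : s = m := by linarith
    rw [hm'] at h0 h1
    have a : 0 < m := by exact_mod_cast h0
    have b : m < 1 := by exact_mod_cast h1
    omega
  have := abs_pos.2 g2
  have := Real.pi_pos
  positivity

end FL

theorem stmt16 (s α : ℝ) (hs0 : 0 < s) (hs1 : s < 1) (hα : max 0 (1 - 2*s) < α)
    (f f' : ℝ → ℝ) (hf : IsC1Alpha f f' α)
    (u : EuclideanSpace ℝ (Fin 2) → ℝ) (hu : IsStableSolution 2 s f f' u)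
    (hu1 : ∀ x, |u x| < 1) :
    ∃ e : EuclideanSpace ℝ (Fin 2), ‖e‖ = 1 ∧ ∃ g : ℝ → ℝ,
      ∀ x : EuclideanSpace ℝ (Fin 2), u x = g (@inner ℝ _ _ x e) := by
  obtain ⟨hu2, hub, heq, hst⟩ := hu
  obtain ⟨hf1, Cα, hC0, hfα⟩ := hf
  have hα0 : 0 < α := lt_of_le_of_lt (le_max_left _ _) hα
  have hmem : ∀ x, u x ∈ Set.Icc (-1:ℝ) 1 := fun x => abs_le.1 (hub x)
  have huc := hu2.continuous
  have hqc : Continuous (fun x => f' (u x)) := by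
    rw [continuous_iff_continuousAt]
    intro x
    have hb : Continuous (fun y => Cα * |u y - u x| ^ α) :=
      continuous_const.mul ((huc.sub continuous_const).abs.rpow_const fun _ => Or.inr hα0.le)
    have ht := hb.tendsto x
    simp only [sub_self, abs_zero, Real.zero_rpow hα0.ne', mul_zero] at ht
    show Filter.Tendsto _ _ _
    rw [tendsto_iff_norm_sub_tendsto_zero]
    exact squeeze_zero (fun _ => norm_nonneg _) (fun y => hfα _ (hmem y) _ (hmem x)) ht
  have hdu := hu2.differentiable (by norm_num)
  have hFd : ∀ x, HasFDerivAt (fun x => f (u x)) (f' (u x) • fderiv ℝ u x) x := fun x =>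
    (hf1 _ (hmem x)).comp_hasFDerivAt x (hdu x).hasFDerivAt
  have hF1 : ContDiff ℝ 1 (fun x => f (u x)) := by
    rw [contDiff_one_iff_fderiv]
    refine ⟨fun x => (hFd x).differentiableAt, ?_⟩
    have : fderiv ℝ (fun x => f (u x)) = fun x => f' (u x) • fderiv ℝ u x := funext fun x => (hFd x).fderiv
    rw [this]
    exact hqc.smul (hu2.continuous_fderiv (by norm_num))
  have hfc : ContinuousOn f (Set.Icc (-1:ℝ) 1) := fun x hx => (hf1 x hx).continuousAt.continuousWithinAt
  obtain ⟨MF, hMF⟩ := isCompact_Icc.exists_bound_of_continuousOn hfc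
  have hFb : ∀ x, |f (u x)| ≤ MF := fun x => hMF _ (hmem x)
  have heq' : ∀ x, fracC 2 s / 2 * ∫ y, (2 * u x - u (x+y) - u (x-y)) * FL.K s y = f (u x) := fun x => by
    rw [← heq x]
    simp only [FL.K, div_eq_mul_inv, Nat.cast_ofNat]
  refine FL.geom hu2 fun e he => ?_
  by_contra hcon
  push Not at hcon
  obtain ⟨⟨y0, hy0⟩, ⟨x0, hx0⟩⟩ := hcon
  exact FL.sgn hs0 hs1 (FL.fracC_pos hs0 hs1) hu2 hub hqc hF1 hFb e he
    (fun x => by simp [FL.dd, (hFd x).fderiv]) heq' hst hx0 hy0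
end

section
/- Let d ≥ 1, 0 < s < 1, and let F : ℝ → [0,∞) be continuous. For an open bounded set Ω ⊆ ℝ^d and measurable w : ℝ^d → [−1,1] define J(w,Ω) = J^s(w,Ω) + ∫_Ω F(w(x)) dx. Let u, u⁻, u⁺ : ℝ^d → [−1,1] be measurable with u⁻ ≤ u ≤ u⁺ pointwise, and assume J(u,Ω), J(u⁻,Ω), J(u⁺,Ω) < ∞ for every open bounded Ω. Assume: (i) u⁻ and u⁺ are local minimizers of J, i.e., for every open bounded Ω ⊆ ℝ^d and every measurable v : ℝ^d → [−1,1] with v = u⁻ outside Ω one has J(v,Ω) ≥ J(u⁻,Ω), and the analogous statement for u⁺; (ii) u is a local minimizer of J in the constrained class, i.e., for every open bounded Ω ⊆ ℝ^d and every measurable v : ℝ^d → [−1,1] with u⁻ ≤ v ≤ u⁺ pointwise and v = u outside Ω one has J(v,Ω) ≥ J(u,Ω). Then u is an unconstrained local minimizer of J: for every open bounded Ω ⊆ ℝ^d and every measurable v : ℝ^d → [−1,1] with v = u outside Ω, one has J(v,Ω) ≥ J(u,Ω). -/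
open MeasureTheory Metric Set
open scoped ENNReal NNReal

/-- The total energy `J(w,Ω) = J^s(w,Ω) + ∫_Ω F(w(x)) dx`, valued in `[0,∞]`. -/
noncomputable def Jtot (d : ℕ) (s : ℝ) (F : ℝ → ℝ) (w : EuclideanSpace ℝ (Fin d) → ℝ)
    (Ω : Set (EuclideanSpace ℝ (Fin d))) : ℝ≥0∞ :=
  Js d s w Ω + ENNReal.ofReal (∫ x in Ω, F (w x))

lemma sq_minmax (a b c e : ℝ) :
    (min a b - min c e)^2 + (max a b - max c e)^2 ≤ (a - c)^2 + (b - e)^2 := by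
  rcases le_total a b with h | h <;> rcases le_total c e with h' | h' <;>
    simp only [min_eq_left, min_eq_right, max_eq_left, max_eq_right, h, h'] <;>
    nlinarith [mul_nonneg (sub_nonneg.2 h) (sub_nonneg.2 h')]

lemma measurable_kern (d : ℕ) (s : ℝ) (v : EuclideanSpace ℝ (Fin d) → ℝ) (hv : Measurable v) :
    Measurable (fun p : EuclideanSpace ℝ (Fin d) × EuclideanSpace ℝ (Fin d) =>
      ENNReal.ofReal ((v p.1 - v p.2)^2 / ‖p.1 - p.2‖ ^ ((d : ℝ) + 2*s))) := by
  have h1 : Measurable (fun p : EuclideanSpace ℝ (Fin d) × EuclideanSpace ℝ (Fin d) =>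
      ‖p.1 - p.2‖) := (continuous_fst.sub continuous_snd).norm.measurable
  exact ((((hv.comp measurable_fst).sub (hv.comp measurable_snd)).pow_const 2).div
    (h1.pow_const _)).ennreal_ofReal

lemma Js_submod (d : ℕ) (s : ℝ) (v w : EuclideanSpace ℝ (Fin d) → ℝ)
    (hv : Measurable v) (hw : Measurable w) (Ω : Set (EuclideanSpace ℝ (Fin d))) :
    Js d s (fun x => min (v x) (w x)) Ω + Js d s (fun x => max (v x) (w x)) Ω
      ≤ Js d s v Ω + Js d s w Ω := by
  unfold Js
  rw [← lintegral_add_left (measurable_kern d s _ (hv.min hw)),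
    ← lintegral_add_left (measurable_kern d s _ hv)]
  refine lintegral_mono fun p => ?_
  have hk : 0 ≤ ‖p.1 - p.2‖ ^ ((d : ℝ) + 2*s) := Real.rpow_nonneg (norm_nonneg _) _
  rw [← ENNReal.ofReal_add (div_nonneg (sq_nonneg _) hk) (div_nonneg (sq_nonneg _) hk),
    ← ENNReal.ofReal_add (div_nonneg (sq_nonneg _) hk) (div_nonneg (sq_nonneg _) hk),
    ← add_div, ← add_div]
  exact ENNReal.ofReal_le_ofReal (div_le_div_of_nonneg_right (sq_minmax _ _ _ _) hk)

lemma integrable_F (d : ℕ) (F : ℝ → ℝ) (hFc : Continuous F)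
    (v : EuclideanSpace ℝ (Fin d) → ℝ) (hv : Measurable v)
    (hvr : ∀ x, v x ∈ Set.Icc (-1 : ℝ) 1) (Ω : Set (EuclideanSpace ℝ (Fin d)))
    (hb : Bornology.IsBounded Ω) :
    IntegrableOn (fun x => F (v x)) Ω := by
  obtain ⟨C, hC⟩ := (isCompact_Icc (a := (-1 : ℝ)) (b := 1)).exists_bound_of_continuousOn
    hFc.continuousOn
  exact Measure.integrableOn_of_bounded (M := C) hb.measure_lt_top.ne
    (hFc.measurable.comp hv).aestronglyMeasurable
    (Filter.Eventually.of_forall fun x => hC _ (hvr x))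

lemma Icc_min {a b : ℝ} (ha : a ∈ Set.Icc (-1 : ℝ) 1) (hb : b ∈ Set.Icc (-1 : ℝ) 1) :
    min a b ∈ Set.Icc (-1 : ℝ) 1 := ⟨le_min ha.1 hb.1, (min_le_left _ _).trans ha.2⟩

lemma Icc_max {a b : ℝ} (ha : a ∈ Set.Icc (-1 : ℝ) 1) (hb : b ∈ Set.Icc (-1 : ℝ) 1) :
    max a b ∈ Set.Icc (-1 : ℝ) 1 := ⟨ha.1.trans (le_max_left _ _), max_le ha.2 hb.2⟩

lemma Jtot_submod (d : ℕ) (s : ℝ) (F : ℝ → ℝ) (hFc : Continuous F) (hF0 : ∀ t, 0 ≤ F t)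
    (v w : EuclideanSpace ℝ (Fin d) → ℝ)
    (hv : Measurable v) (hw : Measurable w)
    (hvr : ∀ x, v x ∈ Set.Icc (-1 : ℝ) 1) (hwr : ∀ x, w x ∈ Set.Icc (-1 : ℝ) 1)
    (Ω : Set (EuclideanSpace ℝ (Fin d))) (hb : Bornology.IsBounded Ω) :
    Jtot d s F (fun x => min (v x) (w x)) Ω + Jtot d s F (fun x => max (v x) (w x)) Ω
      ≤ Jtot d s F v Ω + Jtot d s F w Ω := by
  unfold Jtot
  rw [add_add_add_comm, add_add_add_comm (Js d s v Ω)]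
  refine add_le_add (Js_submod d s v w hv hw Ω) (le_of_eq ?_)
  have hnn : ∀ z : EuclideanSpace ℝ (Fin d) → ℝ, 0 ≤ ∫ x in Ω, F (z x) :=
    fun z => integral_nonneg fun x => hF0 _
  rw [← ENNReal.ofReal_add (hnn _) (hnn _), ← ENNReal.ofReal_add (hnn _) (hnn _),
    ← integral_add
      (integrable_F d F hFc _ (hv.min hw) (fun x => Icc_min (hvr x) (hwr x)) Ω hb)
      (integrable_F d F hFc _ (hv.max hw) (fun x => Icc_max (hvr x) (hwr x)) Ω hb),
    ← integral_add (integrable_F d F hFc _ hv hvr Ω hb) (integrable_F d F hFc _ hw hwr Ω hb)]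
  congr 2
  funext x
  rcases le_total (v x) (w x) with h | h <;> simp [h, add_comm]

/-- Let `d ≥ 1`, `0 < s < 1`, `F : ℝ → [0,∞)` continuous, and
`u⁻ ≤ u ≤ u⁺` measurable functions `ℝ^d → [−1,1]` with finite energies on bounded open sets.
If `u⁻` and `u⁺` are (unconstrained) local minimizers of `J` and `u` is a local minimizer of
`J` in the constrained class `{v : u⁻ ≤ v ≤ u⁺}`, then `u` is an unconstrained local
minimizer of `J`. -/
theorem stmt17 (d : ℕ) (hd : 1 ≤ d) (s : ℝ) (hs0 : 0 < s) (hs1 : s < 1)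
    (F : ℝ → ℝ) (hFc : Continuous F) (hF0 : ∀ t, 0 ≤ F t)
    (u um up : EuclideanSpace ℝ (Fin d) → ℝ)
    (hum : Measurable um) (hu : Measurable u) (hup : Measurable up)
    (humr : ∀ x, um x ∈ Set.Icc (-1 : ℝ) 1)
    (hur : ∀ x, u x ∈ Set.Icc (-1 : ℝ) 1)
    (hupr : ∀ x, up x ∈ Set.Icc (-1 : ℝ) 1)
    (horder : ∀ x, um x ≤ u x ∧ u x ≤ up x)
    (hfin : ∀ Ω : Set (EuclideanSpace ℝ (Fin d)), IsOpen Ω → Bornology.IsBounded Ω →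
      Jtot d s F u Ω < ⊤ ∧ Jtot d s F um Ω < ⊤ ∧ Jtot d s F up Ω < ⊤)
    (hmin_m : ∀ Ω : Set (EuclideanSpace ℝ (Fin d)), IsOpen Ω → Bornology.IsBounded Ω →
      ∀ v : EuclideanSpace ℝ (Fin d) → ℝ, Measurable v →
        (∀ x, v x ∈ Set.Icc (-1 : ℝ) 1) → (∀ x ∉ Ω, v x = um x) →
        Jtot d s F um Ω ≤ Jtot d s F v Ω)
    (hmin_p : ∀ Ω : Set (EuclideanSpace ℝ (Fin d)), IsOpen Ω → Bornology.IsBounded Ω →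
      ∀ v : EuclideanSpace ℝ (Fin d) → ℝ, Measurable v →
        (∀ x, v x ∈ Set.Icc (-1 : ℝ) 1) → (∀ x ∉ Ω, v x = up x) →
        Jtot d s F up Ω ≤ Jtot d s F v Ω)
    (hmin_c : ∀ Ω : Set (EuclideanSpace ℝ (Fin d)), IsOpen Ω → Bornology.IsBounded Ω →
      ∀ v : EuclideanSpace ℝ (Fin d) → ℝ, Measurable v →
        (∀ x, v x ∈ Set.Icc (-1 : ℝ) 1) → (∀ x, um x ≤ v x ∧ v x ≤ up x) →
        (∀ x ∉ Ω, v x = u x) → Jtot d s F u Ω ≤ Jtot d s F v Ω) :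
    ∀ Ω : Set (EuclideanSpace ℝ (Fin d)), IsOpen Ω → Bornology.IsBounded Ω →
      ∀ v : EuclideanSpace ℝ (Fin d) → ℝ, Measurable v →
        (∀ x, v x ∈ Set.Icc (-1 : ℝ) 1) → (∀ x ∉ Ω, v x = u x) →
        Jtot d s F u Ω ≤ Jtot d s F v Ω := by
  intro Ω hΩ hb v hv hvr hvu
  obtain ⟨-, hfm, hfp⟩ := hfin Ω hΩ hb
  have h1 : Jtot d s F (fun x => max (v x) (um x)) Ω ≤ Jtot d s F v Ω := by
    have hsub := Jtot_submod d s F hFc hF0 v um hv hum hvr humr Ω hb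
    have hm := hmin_m Ω hΩ hb (fun x => min (v x) (um x)) (hv.min hum)
      (fun x => Icc_min (hvr x) (humr x))
      (fun x hx => by simp only [hvu x hx]; exact min_eq_right (horder x).1)
    have := (add_le_add_left hm (Jtot d s F (fun x => max (v x) (um x)) Ω)).trans hsub
    rw [add_comm] at this
    exact (ENNReal.add_le_add_iff_right hfm.ne).1 this
  have hwm : Measurable (fun x => max (v x) (um x)) := hv.max hum
  have hwr : ∀ x, max (v x) (um x) ∈ Set.Icc (-1 : ℝ) 1 := fun x => Icc_max (hvr x) (humr x)
  have hwu : ∀ x ∉ Ω, max (v x) (um x) = u x := fun x hx => by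
    rw [hvu x hx]; exact max_eq_left (horder x).1
  have h2 : Jtot d s F (fun x => min (max (v x) (um x)) (up x)) Ω
      ≤ Jtot d s F (fun x => max (v x) (um x)) Ω := by
    have hsub := Jtot_submod d s F hFc hF0 _ up hwm hup hwr hupr Ω hb
    have hm := hmin_p Ω hΩ hb (fun x => max (max (v x) (um x)) (up x)) (hwm.max hup)
      (fun x => Icc_max (hwr x) (hupr x))
      (fun x hx => by simp only [hwu x hx]; exact max_eq_right (horder x).2)
    exact (ENNReal.add_le_add_iff_right hfp.ne).1 ((add_le_add le_rfl hm).trans hsub)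
  have h3 := hmin_c Ω hΩ hb (fun x => min (max (v x) (um x)) (up x)) (hwm.min hup)
    (fun x => Icc_min (hwr x) (hupr x))
    (fun x => ⟨le_min (le_max_right _ _) ((horder x).1.trans (horder x).2), min_le_right _ _⟩)
    (fun x hx => by simp only [hwu x hx]; exact min_eq_left (horder x).2)
  exact h3.trans (h2.trans h1)
end
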